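/- Let ε ≥ 0 and let ρ₀, ρ₁ be positive definite density matrices in M_n(ℂ). Under the standing assumptions (detailed balance with respect to an invertible density matrix σ and ergodicity of L), the anticommutator-case transport distance satisfies the duality formula ½·W_{anti,ε}²(ρ₀,ρ₁) = sup{ τ(A(1)ρ₁ − A(0)ρ₀) : A an anticommutator HJB_ε subsolution }. -/

import Mathlib

open MeasureTheory Matrix
open scoped ENNReal Classical ComplexOrder

/-- Normalized trace `τ(A) = Tr(A)/n` on `M_n(ℂ)`. -/
noncomputable def tau {N : Type*} [Fintype N] (A : Matrix N N ℂ) : ℂ :=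
  A.trace / (Fintype.card N)

/-- GNS inner product `⟨A,B⟩ = τ(A* B)`, conjugate-linear in the first argument. -/
noncomputable def gns {N : Type*} [Fintype N] (A B : Matrix N N ℂ) : ℂ := tau (Aᴴ * B)

/-- Fractional power `X^s` of a positive semidefinite matrix via functional calculus
(junk value `0` if `X` is not hermitian). -/
noncomputable def mpow {N : Type*} [Fintype N] [DecidableEq N] (X : Matrix N N ℂ) (s : ℝ) :
    Matrix N N ℂ :=
  if hX : X.IsHermitian then
    (Matrix.IsHermitian.eigenvectorUnitary hX : Matrix N N ℂ) *
      Matrix.diagonal (fun i => ((hX.eigenvalues i ^ s : ℝ) : ℂ)) *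
      (star (Matrix.IsHermitian.eigenvectorUnitary hX : Matrix N N ℂ))
  else 0

/-- The operator `[X]_α(A) = ∫₀¹ e^{α(s-1/2)} X^s A X^{1-s} ds` on `M_n(ℂ)`. -/
noncomputable def sandwich {N : Type*} [Fintype N] [DecidableEq N] (X : Matrix N N ℂ) (α : ℝ)
    (A : Matrix N N ℂ) : Matrix N N ℂ :=
  Matrix.of fun i k =>
    ∫ s in (0:ℝ)..1, Real.exp (α * (s - 1/2)) • ((mpow X s * A * mpow X (1 - s)) i k)

section H

variable {N : Type*} [Fintype N] [DecidableEq N] {J : Type*} [Fintype J]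

/-- Inner product on `H = ⊕_{j ∈ J} M_n(ℂ)`. -/
noncomputable def gnsH (V W : J → Matrix N N ℂ) : ℂ := ∑ j, gns (V j) (W j)

/-- The operator `[ρ]_ω = ⊕_j [ρ]_{ω_j}` on `H`. -/
noncomputable def opOmega (ω : J → ℝ) (ρ : Matrix N N ℂ) (W : J → Matrix N N ℂ) :
    J → Matrix N N ℂ :=
  fun j => sandwich ρ (ω j) (W j)

/-- Extended value `⟨V, K⁻¹ V⟩ ∈ [0,∞]`: equals `⟨W, K W⟩` if `V = K W` with
`W ⊥ ker K`, and `∞` if `V ∉ ran K`. -/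
noncomputable def invQuadH (K : (J → Matrix N N ℂ) → (J → Matrix N N ℂ))
    (V : J → Matrix N N ℂ) : ℝ≥0∞ :=
  if h : ∃ W, K W = V ∧ ∀ U, K U = 0 → gnsH W U = 0
  then ENNReal.ofReal (gnsH h.choose (K h.choose)).re
  else ⊤

/-- The partial derivative `∂_j A = [V_j, A]`; `gradD V A = ∇A`. -/
noncomputable def gradD (Vf : J → Matrix N N ℂ) (A : Matrix N N ℂ) : J → Matrix N N ℂ :=
  fun j => Vf j * A - A * Vf j

/-- The Lindblad generator `L(A) = ∑_j (e^{-ω_j/2} V_j^*[A,V_j] - e^{ω_j/2}[A,V_j]V_j^*)`. -/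
noncomputable def genL (Vf : J → Matrix N N ℂ) (ω : J → ℝ) (A : Matrix N N ℂ) :
    Matrix N N ℂ :=
  ∑ j, (Real.exp (-ω j / 2) • ((Vf j)ᴴ * (A * Vf j - Vf j * A)) -
        Real.exp (ω j / 2) • ((A * Vf j - Vf j * A) * (Vf j)ᴴ))

/-- Membership in `CE_ε(ρ₀,ρ₁)`: `ρ` is a C¹ curve of invertible density matrices joining
`ρ₀` to `ρ₁`, `Vc` is continuous, and the continuity equation
`ρ'(t) + div Vc(t) = ε L†ρ(t)` holds on `[0,1]`. -/
def IsCE (dvg : (J → Matrix N N ℂ) → Matrix N N ℂ) (Ldag : Matrix N N ℂ → Matrix N N ℂ)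
    (ε : ℝ) (ρ₀ ρ₁ : Matrix N N ℂ) (ρ : ℝ → Matrix N N ℂ) (Vc : ℝ → J → Matrix N N ℂ) :
    Prop :=
  ρ 0 = ρ₀ ∧ ρ 1 = ρ₁ ∧
  (∀ t ∈ Set.Icc (0:ℝ) 1, (ρ t).PosDef ∧ tau (ρ t) = 1) ∧
  (∀ j i k, ContinuousOn (fun t => Vc t j i k) (Set.Icc (0:ℝ) 1)) ∧
  ∃ ρ' : ℝ → Matrix N N ℂ,
    (∀ t ∈ Set.Icc (0:ℝ) 1, ∀ i k, HasDerivAt (fun s => ρ s i k) (ρ' t i k) t) ∧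
    (∀ i k, ContinuousOn (fun t => ρ' t i k) (Set.Icc (0:ℝ) 1)) ∧
    (∀ t ∈ Set.Icc (0:ℝ) 1, ρ' t + dvg (Vc t) = ε • Ldag (ρ t))

/-- The squared entropic transport distance `W_ε²(ρ₀,ρ₁)`. -/
noncomputable def Wsq (ω : J → ℝ) (dvg : (J → Matrix N N ℂ) → Matrix N N ℂ)
    (Ldag : Matrix N N ℂ → Matrix N N ℂ) (ε : ℝ) (ρ₀ ρ₁ : Matrix N N ℂ) : ℝ≥0∞ :=
  ⨅ (ρ : ℝ → Matrix N N ℂ) (Vc : ℝ → J → Matrix N N ℂ)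
    (_ : IsCE dvg Ldag ε ρ₀ ρ₁ ρ Vc),
      ∫⁻ t in Set.Icc (0:ℝ) 1, invQuadH (opOmega ω (ρ t)) (Vc t)

/-- Hamilton–Jacobi–Bellmann subsolutions: `A` is a C¹ curve of hermitian matrices with
`τ((Ȧ(t) + ε L A(t))ρ) + ½⟨∇A(t), [ρ]_ω ∇A(t)⟩ ≤ 0` for all `t ∈ [0,1]` and all
density matrices `ρ`.  (`A'` records the derivative of `A`.) -/
noncomputable def IsHJB (Vf : J → Matrix N N ℂ) (ω : J → ℝ) (ε : ℝ)
    (A A' : ℝ → Matrix N N ℂ) : Prop :=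
  (∀ t ∈ Set.Icc (0:ℝ) 1, (A t).IsHermitian) ∧
  (∀ t ∈ Set.Icc (0:ℝ) 1, ∀ i k, HasDerivAt (fun s => A s i k) (A' t i k) t) ∧
  (∀ i k, ContinuousOn (fun t => A' t i k) (Set.Icc (0:ℝ) 1)) ∧
  ∀ t ∈ Set.Icc (0:ℝ) 1, ∀ ρ : Matrix N N ℂ, ρ.PosSemidef → tau ρ = 1 →
    (tau ((A' t + ε • genL Vf ω (A t)) * ρ)).re
      + (1/2) * (gnsH (gradD Vf (A t)) (opOmega ω ρ (gradD Vf (A t)))).re ≤ 0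

end H

/-- The anticommutator operator `[ρ]_anti` on `H`: `([ρ]_anti V)_j = ½(ρ V_j + V_j ρ)`. -/
noncomputable def opAnti {N : Type*} [Fintype N] {J : Type*}
    (ρ : Matrix N N ℂ) (W : J → Matrix N N ℂ) : J → Matrix N N ℂ :=
  fun j => (1/2 : ℂ) • (ρ * W j + W j * ρ)

/-- The squared anticommutator-case entropic transport distance `W_{anti,ε}²(ρ₀,ρ₁)`. -/
noncomputable def WsqAnti {N : Type*} [Fintype N] [DecidableEq N] {J : Type*} [Fintype J]
    (dvg : (J → Matrix N N ℂ) → Matrix N N ℂ)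
    (Ldag : Matrix N N ℂ → Matrix N N ℂ) (ε : ℝ) (ρ₀ ρ₁ : Matrix N N ℂ) : ℝ≥0∞ :=
  ⨅ (ρ : ℝ → Matrix N N ℂ) (Vc : ℝ → J → Matrix N N ℂ)
    (_ : IsCE dvg Ldag ε ρ₀ ρ₁ ρ Vc),
      ∫⁻ t in Set.Icc (0:ℝ) 1, invQuadH (opAnti (ρ t)) (Vc t)

/-- Anticommutator Hamilton–Jacobi–Bellmann subsolutions: C¹ curves `A` of hermitian
matrices with `τ((Ȧ(t) + ε L A(t))ρ) + ½⟨∇A(t), [ρ]_anti ∇A(t)⟩ ≤ 0` for all `t ∈ [0,1]`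
and all density matrices `ρ`. -/
noncomputable def IsHJBanti {N : Type*} [Fintype N] [DecidableEq N] {J : Type*} [Fintype J]
    (Vf : J → Matrix N N ℂ) (ω : J → ℝ) (ε : ℝ) (A A' : ℝ → Matrix N N ℂ) : Prop :=
  (∀ t ∈ Set.Icc (0:ℝ) 1, (A t).IsHermitian) ∧
  (∀ t ∈ Set.Icc (0:ℝ) 1, ∀ i k, HasDerivAt (fun s => A s i k) (A' t i k) t) ∧
  (∀ i k, ContinuousOn (fun t => A' t i k) (Set.Icc (0:ℝ) 1)) ∧
  ∀ t ∈ Set.Icc (0:ℝ) 1, ∀ ρ : Matrix N N ℂ, ρ.PosSemidef → tau ρ = 1 →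
    (tau ((A' t + ε • genL Vf ω (A t)) * ρ)).re
      + (1/2) * (gnsH (gradD Vf (A t)) (opAnti ρ (gradD Vf (A t)))).re ≤ 0

section Algebra

set_option linter.unusedSectionVars false

variable {N : Type*} [Fintype N] [DecidableEq N] {J : Type*} [Fintype J]

theorem gns_eq_sum (A B : Matrix N N ℂ) :
    gns A B = (∑ i, ∑ k, star (A i k) * B i k) / (Fintype.card N) := by
  unfold gns tau
  congr 1
  simp only [Matrix.trace, Matrix.diag, Matrix.mul_apply, Matrix.conjTranspose_apply]
  exact Finset.sum_comm

theorem gns_add_left (A B C : Matrix N N ℂ) : gns (A + B) C = gns A C + gns B C := by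
  simp [gns, tau, Matrix.add_mul, add_div]

theorem gns_add_right (A B C : Matrix N N ℂ) : gns A (B + C) = gns A B + gns A C := by
  simp [gns, tau, Matrix.mul_add, add_div]

theorem gns_smul_left (r : ℝ) (A B : Matrix N N ℂ) : gns (r • A) B = r • gns A B := by
  simp [gns, tau, mul_div_assoc]

theorem gns_smul_right (r : ℝ) (A B : Matrix N N ℂ) : gns A (r • B) = r • gns A B := by
  simp [gns, tau, mul_div_assoc]

/-- The real part of the GNS inner product as a real bilinear form. -/
noncomputable def reGns : Matrix N N ℂ →ₗ[ℝ] Matrix N N ℂ →ₗ[ℝ] ℝ :=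
  LinearMap.mk₂ ℝ (fun A B => (gns A B).re)
    (fun A B C => by simp [gns_add_left]) (fun r A B => by simp [gns_smul_left])
    (fun A B C => by simp [gns_add_right]) (fun r A B => by simp [gns_smul_right])

theorem reGns_apply (A B : Matrix N N ℂ) : reGns A B = (gns A B).re := rfl

/-- The real part of the inner product of `H` as a real bilinear form. -/
noncomputable def reGnsH : (J → Matrix N N ℂ) →ₗ[ℝ] (J → Matrix N N ℂ) →ₗ[ℝ] ℝ :=
  LinearMap.mk₂ ℝ (fun V W => ∑ j, reGns (V j) (W j))
    (fun A B C => by simp [Finset.sum_add_distrib]) (fun r A B => by simp [Finset.mul_sum])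
    (fun A B C => by simp [Finset.sum_add_distrib]) (fun r A B => by simp [Finset.mul_sum])

theorem reGnsH_eq_sum (V W : J → Matrix N N ℂ) : reGnsH V W = ∑ j, reGns (V j) (W j) := rfl

theorem reGnsH_apply (V W : J → Matrix N N ℂ) : reGnsH V W = (gnsH V W).re := by
  simp [reGnsH_eq_sum, gnsH, reGns_apply]

/-- `[ρ]_anti W` as a real bilinear map in `(ρ, W)`. -/
noncomputable def antiL :
    Matrix N N ℂ →ₗ[ℝ] (J → Matrix N N ℂ) →ₗ[ℝ] (J → Matrix N N ℂ) :=
  LinearMap.mk₂ ℝ opAnti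
    (fun A B C => by ext1 j; simp [opAnti, add_mul, mul_add]; abel)
    (fun r A B => by ext1 j; simp [opAnti, smul_comm r])
    (fun A B C => by ext1 j; simp [opAnti, add_mul, mul_add]; abel)
    (fun r A B => by ext1 j; simp [opAnti, smul_comm r])

theorem antiL_apply (ρ : Matrix N N ℂ) (W : J → Matrix N N ℂ) : antiL ρ W = opAnti ρ W := rfl

/-- `∇` as a real linear map. -/
noncomputable def gradL (Vf : J → Matrix N N ℂ) : Matrix N N ℂ →ₗ[ℝ] (J → Matrix N N ℂ) where
  toFun := gradD Vf
  map_add' A B := by ext1 j; simp [gradD, mul_add, add_mul]; abel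
  map_smul' r A := by ext1 j; simp [gradD, smul_sub]

theorem gradL_apply (Vf : J → Matrix N N ℂ) (A : Matrix N N ℂ) : gradL Vf A = gradD Vf A := rfl

/-- The generator `L` as a real linear map. -/
noncomputable def genLin (Vf : J → Matrix N N ℂ) (ω : J → ℝ) :
    Matrix N N ℂ →ₗ[ℝ] Matrix N N ℂ where
  toFun := genL Vf ω
  map_add' A B := by
    simp only [genL, ← Finset.sum_add_distrib]
    refine Finset.sum_congr rfl fun j _ => ?_
    simp only [mul_add, add_mul, mul_sub, sub_mul, smul_add, smul_sub]
    abel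
  map_smul' r A := by
    simp only [genL, Finset.smul_sum, RingHom.id_apply]
    refine Finset.sum_congr rfl fun j _ => ?_
    simp only [mul_sub, sub_mul, smul_sub, Matrix.smul_mul, Matrix.mul_smul, smul_comm r]

theorem genLin_apply (Vf : J → Matrix N N ℂ) (ω : J → ℝ) (A : Matrix N N ℂ) :
    genLin Vf ω A = genL Vf ω A := rfl

/-- A vector field `U(ρ)`, linear in `ρ`, with `div U(ρ) = L†ρ`. -/
noncomputable def heatL (Vf : J → Matrix N N ℂ) (ω : J → ℝ) :
    Matrix N N ℂ →ₗ[ℝ] (J → Matrix N N ℂ) where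
  toFun ρ j := Real.exp (-ω j / 2) • (Vf j * ρ) - Real.exp (ω j / 2) • (ρ * Vf j)
  map_add' A B := by ext1 j; simp [mul_add, add_mul]; abel
  map_smul' r A := by ext1 j; simp [smul_sub, smul_comm r]

theorem heatL_apply (Vf : J → Matrix N N ℂ) (ω : J → ℝ) (ρ : Matrix N N ℂ) (j : J) :
    heatL Vf ω ρ j = Real.exp (-ω j / 2) • (Vf j * ρ) - Real.exp (ω j / 2) • (ρ * Vf j) := rfl

theorem tau_mul_comm (A B : Matrix N N ℂ) : tau (A * B) = tau (B * A) := by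
  simp [tau, Matrix.trace_mul_comm A B]

theorem tau_conjTranspose (A : Matrix N N ℂ) : tau Aᴴ = star (tau A) := by
  simp [tau, Matrix.trace_conjTranspose]

theorem re_tau_conjTranspose (A : Matrix N N ℂ) : (tau Aᴴ).re = (tau A).re := by
  simp [tau_conjTranspose]

theorem tau_add (A B : Matrix N N ℂ) : tau (A + B) = tau A + tau B := by
  simp [tau, add_div]

theorem tau_sub (A B : Matrix N N ℂ) : tau (A - B) = tau A - tau B := by
  simp [tau, sub_div]

theorem tau_smul (r : ℝ) (A : Matrix N N ℂ) : tau (r • A) = r • tau A := by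
  simp [tau, mul_div_assoc]

theorem reGns_comm (A B : Matrix N N ℂ) : reGns A B = reGns B A := by
  rw [reGns_apply, reGns_apply, gns, gns, ← re_tau_conjTranspose]
  simp

theorem reGnsH_comm (V W : J → Matrix N N ℂ) : reGnsH V W = reGnsH W V := by
  simp only [reGnsH_eq_sum]
  exact Finset.sum_congr rfl fun j _ => reGns_comm _ _

theorem reGns_conjTranspose (A B : Matrix N N ℂ) : reGns Aᴴ B = reGns A Bᴴ := by
  rw [reGns_apply, reGns_apply, gns, gns, ← re_tau_conjTranspose, tau_mul_comm Aᴴ]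
  simp

theorem reGns_heat (Vf : J → Matrix N N ℂ) (ω : J → ℝ) (ρ B : Matrix N N ℂ) :
    reGnsH (heatL Vf ω ρ) (gradL Vf B) = - reGns ρ (genLin Vf ω B) := by
  rw [genLin_apply, genL, map_sum, reGnsH_eq_sum, ← Finset.sum_neg_distrib]
  refine Finset.sum_congr rfl fun j _ => ?_
  have h : ∀ X Y Z : Matrix N N ℂ, reGns (X * Y) Z = reGns Y (Xᴴ * Z) := fun X Y Z => by
    simp [reGns_apply, gns, mul_assoc]
  have h' : ∀ X Y Z : Matrix N N ℂ, reGns (X * Y) Z = reGns X (Z * Yᴴ) := fun X Y Z => by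
    simp only [reGns_apply, gns, conjTranspose_mul]
    rw [mul_assoc, tau_mul_comm, mul_assoc]
  rw [heatL_apply, gradL_apply, gradD]
  simp only [map_sub, LinearMap.sub_apply, map_smul, LinearMap.smul_apply, h (Vf j) ρ,
    h' ρ (Vf j), mul_sub, sub_mul]
  simp only [smul_eq_mul]
  ring

theorem card_ne_zero_of_tau {σ : Matrix N N ℂ} (h : tau σ = 1) : (Fintype.card N : ℂ) ≠ 0 := by
  intro h0
  simp [tau, h0] at h

theorem reGns_self_eq_zero (hN : (Fintype.card N : ℂ) ≠ 0) {A : Matrix N N ℂ}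
    (h : reGns A A = 0) : A = 0 := by
  have hN' : (Fintype.card N : ℝ) ≠ 0 := by exact_mod_cast hN
  have h1 : reGns A A = (∑ i, ∑ k, ‖A i k‖ ^ 2) / (Fintype.card N : ℝ) := by
    rw [reGns_apply, gns_eq_sum]
    have : (∑ i, ∑ k, star (A i k) * A i k) / (Fintype.card N : ℂ)
        = (((∑ i, ∑ k, ‖A i k‖ ^ 2) / (Fintype.card N : ℝ) : ℝ) : ℂ) := by
      push_cast
      congr 1
      refine Finset.sum_congr rfl fun i _ => Finset.sum_congr rfl fun k _ => ?_
      exact Complex.conj_mul' _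
    rw [this, Complex.ofReal_re]
  rw [h1, div_eq_zero_iff, or_iff_left hN'] at h
  rw [Finset.sum_eq_zero_iff_of_nonneg (fun i _ => by positivity)] at h
  ext i k
  have h2 := h i (Finset.mem_univ i)
  rw [Finset.sum_eq_zero_iff_of_nonneg (fun i _ => by positivity)] at h2
  simpa using h2 k (Finset.mem_univ k)

theorem eq_of_reGns_eq (hN : (Fintype.card N : ℂ) ≠ 0) {A B : Matrix N N ℂ}
    (h : ∀ X, reGns A X = reGns B X) : A = B := by
  rw [← sub_eq_zero]
  apply reGns_self_eq_zero hN
  rw [LinearMap.map_sub₂, h, sub_self]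

/-- The matrix representing a real linear functional with respect to `reGns`. -/
noncomputable def rieszMatrix (f : Matrix N N ℂ →ₗ[ℝ] ℝ) : Matrix N N ℂ :=
  Matrix.of fun i k => (Fintype.card N : ℂ) *
    (f (Matrix.single i k 1) + Complex.I * f (Matrix.single i k Complex.I))

theorem reGns_rieszMatrix (hN : (Fintype.card N : ℂ) ≠ 0) (f : Matrix N N ℂ →ₗ[ℝ] ℝ)
    (X : Matrix N N ℂ) : reGns (rieszMatrix f) X = f X := by
  have hX : f X = ∑ i, ∑ k, ((X i k).re * f (Matrix.single i k 1) +
      (X i k).im * f (Matrix.single i k Complex.I)) := by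
    conv_lhs => rw [Matrix.matrix_eq_sum_single X]
    simp only [map_sum]
    refine Finset.sum_congr rfl fun i _ => Finset.sum_congr rfl fun k _ => ?_
    have : Matrix.single i k (X i k) = (X i k).re • Matrix.single i k (1 : ℂ) +
        (X i k).im • Matrix.single i k Complex.I := by
      rw [Matrix.smul_single, Matrix.smul_single, ← Matrix.single_add]
      congr 1
      simp
    rw [this, map_add, map_smul, map_smul, smul_eq_mul, smul_eq_mul]
  rw [hX, reGns_apply, gns_eq_sum, Finset.sum_div, Complex.re_sum]
  refine Finset.sum_congr rfl fun i _ => ?_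
  rw [Finset.sum_div, Complex.re_sum]
  refine Finset.sum_congr rfl fun k _ => ?_
  have : star (rieszMatrix f i k) * X i k / (Fintype.card N : ℂ) =
      (f (Matrix.single i k 1) - Complex.I * f (Matrix.single i k Complex.I)) * X i k := by
    simp only [rieszMatrix, Matrix.of_apply, star_mul', star_add, Complex.star_def,
      Complex.conj_natCast, Complex.conj_ofReal, Complex.conj_I]
    field_simp
    ring
  rw [this]
  simp
  ring

end Algebra

section Positivity

set_option linter.unusedSectionVars false

variable {N : Type*} [Fintype N] [DecidableEq N] {J : Type*} [Fintype J]

/-- The carré du champ `Γ(Y) = ½ ∑_j (Y_j Y_j^* + Y_j^* Y_j)`. -/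
noncomputable def carre (Y : J → Matrix N N ℂ) : Matrix N N ℂ :=
  (1 / 2 : ℝ) • ∑ j, (Y j * (Y j)ᴴ + (Y j)ᴴ * Y j)

theorem reGnsH_opAnti_left (ρ : Matrix N N ℂ) (hρ : ρ.IsHermitian) (Y Z : J → Matrix N N ℂ) :
    reGnsH (antiL ρ Y) Z = reGnsH Y (antiL ρ Z) := by
  simp only [reGnsH_eq_sum, antiL_apply, opAnti]
  refine Finset.sum_congr rfl fun j _ => ?_
  simp only [reGns_apply, gns, conjTranspose_smul, conjTranspose_add, conjTranspose_mul, hρ.eq,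
    Matrix.smul_mul, Matrix.mul_smul, Matrix.add_mul, Matrix.mul_add]
  simp only [tau, trace_smul, trace_add]
  rw [Matrix.mul_assoc, Matrix.mul_assoc, Matrix.trace_mul_comm ρ, Matrix.mul_assoc]
  simp

theorem anti_form_eq (ρ : Matrix N N ℂ) (Y Z : J → Matrix N N ℂ) :
    reGnsH Y (antiL ρ Z) =
      ∑ j, (1 / 2) * ((tau ((Y j)ᴴ * ρ * Z j)).re + (tau (Z j * ρ * (Y j)ᴴ)).re) := by
  simp only [reGnsH_eq_sum, antiL_apply, opAnti]
  refine Finset.sum_congr rfl fun j _ => ?_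
  rw [reGns_apply, gns, tau_mul_comm (Z j * ρ), Matrix.mul_smul, Matrix.mul_add,
    ← Matrix.mul_assoc, tau, trace_smul, tau, tau, trace_add, ← Complex.add_re, ← add_div,
    smul_eq_mul, mul_div_assoc]
  have : (1 / 2 : ℂ) = ((1 / 2 : ℝ) : ℂ) := by norm_num
  rw [this, Complex.re_ofReal_mul]

theorem reGns_carre (ρ : Matrix N N ℂ) (hρ : ρ.IsHermitian) (Y : J → Matrix N N ℂ) :
    reGns ρ (carre Y) = reGnsH Y (antiL ρ Y) := by
  rw [anti_form_eq, carre, map_smul, map_sum, Finset.smul_sum]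
  refine Finset.sum_congr rfl fun j _ => ?_
  rw [reGns_apply, gns, hρ.eq, Matrix.mul_add, tau_add, Complex.add_re, smul_eq_mul,
    tau_mul_comm ((Y j)ᴴ * ρ), tau_mul_comm (Y j * ρ), tau_mul_comm ρ (Y j * (Y j)ᴴ),
    tau_mul_comm ρ ((Y j)ᴴ * Y j), Matrix.mul_assoc, Matrix.mul_assoc]

theorem re_tau_nonneg {A : Matrix N N ℂ} (hA : A.PosSemidef) : 0 ≤ (tau A).re := by
  have h := (Complex.le_def.1 hA.trace_nonneg).1
  have : tau A = A.trace / ((Fintype.card N : ℝ) : ℂ) := by simp [tau]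
  rw [this, Complex.div_ofReal_re]
  exact div_nonneg h (Nat.cast_nonneg _)

theorem anti_form_nonneg {ρ : Matrix N N ℂ} (hρ : ρ.PosSemidef) (Y : J → Matrix N N ℂ) :
    0 ≤ reGnsH Y (antiL ρ Y) := by
  rw [anti_form_eq]
  refine Finset.sum_nonneg fun j _ => ?_
  have h1 := re_tau_nonneg (hρ.conjTranspose_mul_mul_same (Y j))
  have h2 := re_tau_nonneg (hρ.mul_mul_conjTranspose_same (Y j))
  linarith

theorem two_anti_form_le {ρ : Matrix N N ℂ} (hρ : ρ.PosSemidef) (Y Z : J → Matrix N N ℂ) :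
    2 * reGnsH Y (antiL ρ Z) ≤ reGnsH Y (antiL ρ Y) + reGnsH Z (antiL ρ Z) := by
  have h := anti_form_nonneg hρ (Y - Z)
  have h' : reGnsH Z (antiL ρ Y) = reGnsH Y (antiL ρ Z) := by
    rw [← reGnsH_opAnti_left ρ hρ.isHermitian, reGnsH_comm]
  simp only [map_sub, LinearMap.sub_apply] at h
  linarith

theorem antiL_injective {ρ : Matrix N N ℂ} (hρ : ρ.PosDef) (hN : (Fintype.card N : ℂ) ≠ 0) :
    Function.Injective (antiL (J := J) ρ) := by
  rw [injective_iff_map_eq_zero]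
  intro Y hY
  have h := anti_form_eq ρ Y Y
  rw [hY, map_zero, eq_comm, Finset.sum_eq_zero_iff_of_nonneg] at h
  · ext1 j
    have h1 := re_tau_nonneg (hρ.posSemidef.conjTranspose_mul_mul_same (Y j))
    have h2 := re_tau_nonneg (hρ.posSemidef.mul_mul_conjTranspose_same (Y j))
    have h3 : (tau ((Y j)ᴴ * ρ * Y j)).re = 0 := by
      have := h j (Finset.mem_univ j)
      linarith
    have hN' : (Fintype.card N : ℝ) ≠ 0 := by exact_mod_cast hN
    have hp := hρ.posSemidef.conjTranspose_mul_mul_same (Y j)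
    have h4 : ((Y j)ᴴ * ρ * Y j).trace = 0 := by
      have h5 := Complex.le_def.1 hp.trace_nonneg
      have : tau ((Y j)ᴴ * ρ * Y j)
          = ((Y j)ᴴ * ρ * Y j).trace / ((Fintype.card N : ℝ) : ℂ) := by simp [tau]
      rw [this, Complex.div_ofReal_re, div_eq_zero_iff, or_iff_left hN'] at h3
      exact Complex.ext h3 h5.2.symm
    have h6 : (Y j)ᴴ * ρ * Y j = 0 := hp.trace_eq_zero_iff.1 h4
    ext i k
    by_contra hne
    have hx : (Y j) *ᵥ Pi.single k 1 ≠ 0 := by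
      intro h0
      apply hne
      have := congrFun h0 i
      simpa using this
    have h7 := hρ.dotProduct_mulVec_pos hx
    have h8 : star (Y j *ᵥ Pi.single k 1) ⬝ᵥ ρ *ᵥ Y j *ᵥ Pi.single k 1
        = star (Pi.single k 1) ⬝ᵥ ((Y j)ᴴ * ρ * Y j) *ᵥ Pi.single k 1 := by
      rw [star_mulVec, ← Matrix.mulVec_mulVec, ← Matrix.mulVec_mulVec,
        Matrix.dotProduct_mulVec _ (Y j)ᴴ]
    rw [h8, h6] at h7
    simp at h7
  · intro j _
    have h1 := re_tau_nonneg (hρ.posSemidef.conjTranspose_mul_mul_same (Y j))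
    have h2 := re_tau_nonneg (hρ.posSemidef.mul_mul_conjTranspose_same (Y j))
    linarith

theorem invQuadH_opAnti {ρ : Matrix N N ℂ} (hρ : ρ.PosDef) (hN : (Fintype.card N : ℂ) ≠ 0)
    {V W : J → Matrix N N ℂ} (hW : antiL ρ W = V) :
    invQuadH (opAnti ρ) V = ENNReal.ofReal (reGnsH W (antiL ρ W)) := by
  have hinj := antiL_injective (J := J) hρ hN
  have hex : ∃ W, opAnti ρ W = V ∧ ∀ U, opAnti ρ U = 0 → gnsH W U = 0 := by
    refine ⟨W, hW, fun U hU => ?_⟩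
    have : U = 0 := hinj (by rw [antiL_apply, hU, map_zero])
    simp [this, gnsH, gns, tau]
  have hc : hex.choose = W := hinj (by rw [hW]; exact hex.choose_spec.1)
  rw [invQuadH, dif_pos hex, hc, reGnsH_apply, antiL_apply]

theorem antiL_surjective {ρ : Matrix N N ℂ} (hρ : ρ.PosDef) (hN : (Fintype.card N : ℂ) ≠ 0) :
    Function.Surjective (antiL (J := J) ρ) :=
  LinearMap.injective_iff_surjective.1 (antiL_injective hρ hN)

theorem posSemidef_of_reGns (hN : (Fintype.card N : ℂ) ≠ 0) {ρ : Matrix N N ℂ}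
    (h : ∀ X : Matrix N N ℂ,
      (∀ μ : Matrix N N ℂ, μ.PosSemidef → reGns μ X ≤ 0) → reGns ρ X ≤ 0) :
    ρ.PosSemidef := by
  have hskew : ∀ X : Matrix N N ℂ, Xᴴ = -X → reGns ρ X = 0 := by
    intro X hX
    have h0 : ∀ μ : Matrix N N ℂ, μ.PosSemidef → reGns μ X = 0 := by
      intro μ hμ
      have h1 := reGns_conjTranspose μ X
      rw [hμ.isHermitian.eq, hX, map_neg] at h1
      linarith
    refine le_antisymm (h X fun μ hμ => (h0 μ hμ).le) ?_
    have := h (-X) fun μ hμ => by rw [map_neg, h0 μ hμ, neg_zero]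
    rw [map_neg] at this
    linarith
  have hherm : ρ.IsHermitian := by
    have hX : (ρ - ρᴴ)ᴴ = -(ρ - ρᴴ) := by simp
    have h1 := hskew _ hX
    have h2 : reGns ρᴴ (ρ - ρᴴ) = 0 := by
      rw [reGns_conjTranspose, hX, map_neg, h1, neg_zero]
    have h3 : ρ - ρᴴ = 0 := by
      apply reGns_self_eq_zero hN
      rw [LinearMap.map_sub₂, h1, h2, sub_zero]
    exact (sub_eq_zero.1 h3).symm
  refine PosSemidef.of_dotProduct_mulVec_nonneg hherm fun x => ?_
  have hform : ∀ μ : Matrix N N ℂ, μ.IsHermitian →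
      reGns μ (vecMulVec x (star x)) = (star x ⬝ᵥ μ *ᵥ x).re / (Fintype.card N : ℝ) := by
    intro μ hμ
    rw [reGns_apply, gns, hμ.eq, tau, Matrix.mul_vecMulVec, Matrix.trace_vecMulVec,
      dotProduct_comm]
    have : (Fintype.card N : ℂ) = ((Fintype.card N : ℝ) : ℂ) := by simp
    rw [this, Complex.div_ofReal_re]
  have h1 := h (-vecMulVec x (star x)) fun μ hμ => by
    rw [map_neg, hform μ hμ.isHermitian, neg_nonpos]
    exact div_nonneg (Complex.le_def.1 (hμ.dotProduct_mulVec_nonneg x)).1 (Nat.cast_nonneg _)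
  rw [map_neg, hform ρ hherm, neg_nonpos] at h1
  have hN' : (0 : ℝ) < Fintype.card N := by
    have : (Fintype.card N : ℝ) ≠ 0 := by exact_mod_cast hN
    positivity
  have h2 : 0 ≤ (star x ⬝ᵥ ρ *ᵥ x).re := by
    rcases div_nonneg_iff.1 h1 with h | h
    · exact h.1
    · linarith
  exact Complex.le_def.2 ⟨h2, (hherm.im_star_dotProduct_mulVec_self x).symm⟩

end Positivity

section WeakDuality

set_option linter.unusedSectionVars false

variable {N : Type*} [Fintype N] [DecidableEq N] {J : Type*} [Fintype J]

theorem hasDerivAt_reGns {A B : ℝ → Matrix N N ℂ} {A' B' : Matrix N N ℂ} {t : ℝ}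
    (hA : ∀ i k, HasDerivAt (fun s => A s i k) (A' i k) t)
    (hB : ∀ i k, HasDerivAt (fun s => B s i k) (B' i k) t) :
    HasDerivAt (fun s => reGns (A s) (B s)) (reGns A' (B t) + reGns (A t) B') t := by
  have h : HasDerivAt (fun s => gns (A s) (B s)) (gns A' (B t) + gns (A t) B') t := by
    simp only [gns_eq_sum, ← add_div, ← Finset.sum_add_distrib]
    refine HasDerivAt.div_const ?_ _
    refine HasDerivAt.fun_sum fun i _ => HasDerivAt.fun_sum fun k _ => ?_
    exact (hA i k).star.mul (hB i k)
  have h' := Complex.reCLM.hasFDerivAt.comp_hasDerivAt t h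
  rw [map_add] at h'
  exact h'

theorem continuousOn_reGns {A B : ℝ → Matrix N N ℂ} {s : Set ℝ}
    (hA : ∀ i k, ContinuousOn (fun s => A s i k) s)
    (hB : ∀ i k, ContinuousOn (fun s => B s i k) s) :
    ContinuousOn (fun s => reGns (A s) (B s)) s := by
  simp only [reGns_apply, gns_eq_sum]
  refine Complex.continuous_re.comp_continuousOn (ContinuousOn.div_const ?_ _)
  refine continuousOn_finsetSum _ fun i _ => continuousOn_finsetSum _ fun k _ => ?_
  exact (hA i k).star.mul (hB i k)

theorem ofReal_intervalIntegral_le_lintegral {f : ℝ → ℝ}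
    (hf : ContinuousOn f (Set.Icc 0 1)) :
    ENNReal.ofReal (∫ t in (0:ℝ)..1, f t) ≤ ∫⁻ t in Set.Icc (0:ℝ) 1, ENNReal.ofReal (f t) := by
  have hint : IntegrableOn f (Set.Icc 0 1) := hf.integrableOn_Icc
  have hmax : IntegrableOn (fun t => max (f t) 0) (Set.Icc 0 1) :=
    (hf.sup continuousOn_const).integrableOn_Icc
  rw [intervalIntegral.integral_of_le zero_le_one, ← integral_Icc_eq_integral_Ioc]
  calc ENNReal.ofReal (∫ t in Set.Icc (0:ℝ) 1, f t)
      ≤ ENNReal.ofReal (∫ t in Set.Icc (0:ℝ) 1, max (f t) 0) :=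
        ENNReal.ofReal_le_ofReal (integral_mono hint hmax fun t => le_max_left _ _)
    _ = ∫⁻ t in Set.Icc (0:ℝ) 1, ENNReal.ofReal (max (f t) 0) :=
        ofReal_integral_eq_lintegral_ofReal hmax
          (Filter.Eventually.of_forall fun t => le_max_right _ _)
    _ = _ := by simp

theorem re_gns_of_isHermitian {ρ : Matrix N N ℂ} (hρ : ρ.IsHermitian) (A : Matrix N N ℂ) :
    (tau (A * ρ)).re = reGns ρ A := by
  rw [reGns_apply, gns, hρ.eq, tau_mul_comm]

theorem le_action_of_isHJBanti {ε : ℝ} {Vf : J → Matrix N N ℂ} {ω : J → ℝ}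
    {dvg : (J → Matrix N N ℂ) → Matrix N N ℂ}
    (hdvg : ∀ (W : J → Matrix N N ℂ) (B : Matrix N N ℂ),
      gns (dvg W) B = -∑ j, gns (W j) (Vf j * B - B * Vf j))
    {Ldag : Matrix N N ℂ → Matrix N N ℂ}
    (hLdag : ∀ ρ B : Matrix N N ℂ, gns (Ldag ρ) B = gns ρ (genL Vf ω B))
    (hN : (Fintype.card N : ℂ) ≠ 0)
    {ρ₀ ρ₁ : Matrix N N ℂ} {ρ : ℝ → Matrix N N ℂ} {V : ℝ → J → Matrix N N ℂ}
    (hCE : IsCE dvg Ldag ε ρ₀ ρ₁ ρ V) {A A' : ℝ → Matrix N N ℂ} (hA : IsHJBanti Vf ω ε A A') :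
    ENNReal.ofReal (tau (A 1 * ρ₁ - A 0 * ρ₀)).re ≤
      (∫⁻ t in Set.Icc (0:ℝ) 1, invQuadH (opAnti (ρ t)) (V t)) / 2 := by
  obtain ⟨h0, h1, hpos, -, ρ', hρ', hρ'c, heq⟩ := hCE
  obtain ⟨-, hA', hA'c, hsub⟩ := hA
  have hAc : ∀ i k, ContinuousOn (fun t => A t i k) (Set.Icc 0 1) := fun i k t ht =>
    (hA' t ht i k).continuousAt.continuousWithinAt
  have hρc : ∀ i k, ContinuousOn (fun t => ρ t i k) (Set.Icc 0 1) := fun i k t ht =>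
    (hρ' t ht i k).continuousAt.continuousWithinAt
  have hcont : ContinuousOn (fun t => reGns (ρ' t) (A t) + reGns (ρ t) (A' t)) (Set.Icc 0 1) :=
    (continuousOn_reGns hρ'c hAc).add (continuousOn_reGns hρc hA'c)
  have hftc : ∫ t in (0:ℝ)..1, (reGns (ρ' t) (A t) + reGns (ρ t) (A' t)) =
      (tau (A 1 * ρ₁ - A 0 * ρ₀)).re := by
    rw [intervalIntegral.integral_eq_sub_of_hasDerivAt
      (f := fun t => reGns (ρ t) (A t)) _ (hcont.intervalIntegrable_of_Icc zero_le_one)]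
    · rw [tau_sub, Complex.sub_re, ← h0, ← h1,
        re_gns_of_isHermitian (hpos 1 (by simp)).1.isHermitian,
        re_gns_of_isHermitian (hpos 0 (by simp)).1.isHermitian]
    · intro t ht
      rw [Set.uIcc_of_le zero_le_one] at ht
      exact hasDerivAt_reGns (hρ' t ht) (hA' t ht)
  rw [← hftc, ENNReal.div_eq_inv_mul, ← lintegral_const_mul' _ _ (by simp)]
  refine (ofReal_intervalIntegral_le_lintegral hcont).trans ?_
  refine setLIntegral_mono' measurableSet_Icc fun t ht => ?_
  obtain ⟨hρpos, hρtr⟩ := hpos t ht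
  obtain ⟨W, hW⟩ := antiL_surjective hρpos hN (V t)
  rw [invQuadH_opAnti hρpos hN hW, show (2⁻¹ : ℝ≥0∞) = ENNReal.ofReal (1 / 2) by
    rw [one_div, ENNReal.ofReal_inv_of_pos two_pos]; simp, ← ENNReal.ofReal_mul (by norm_num)]
  refine ENNReal.ofReal_le_ofReal ?_
  have hs := hsub t ht (ρ t) hρpos.posSemidef hρtr
  rw [re_gns_of_isHermitian hρpos.isHermitian, map_add, map_smul, ← reGnsH_apply, ← gradL_apply,
    ← antiL_apply] at hs
  have hCE' : reGns (ρ' t) (A t) + -reGnsH (V t) (gradL Vf (A t)) =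
      ε • reGns (ρ t) (genL Vf ω (A t)) := by
    have h2 : reGns (dvg (V t)) (A t) = -reGnsH (V t) (gradL Vf (A t)) := by
      rw [reGns_apply, hdvg, reGnsH_apply, Complex.neg_re]
      rfl
    have h3 : reGns (Ldag (ρ t)) (A t) = reGns (ρ t) (genL Vf ω (A t)) := by
      rw [reGns_apply, hLdag, reGns_apply]
    rw [← h2, ← h3, ← LinearMap.map_add₂, heq t ht, LinearMap.map_smul₂]
  have hy := two_anti_form_le hρpos.posSemidef (gradL Vf (A t)) W
  rw [hW, reGnsH_comm _ (V t)] at hy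
  rw [hW] at *
  linarith

end WeakDuality

section Structure

set_option linter.unusedSectionVars false

variable {N : Type*} [Fintype N] [DecidableEq N] {J : Type*} [Fintype J]

theorem genL_conjTranspose {st : J → J} {Vf : J → Matrix N N ℂ} {ω : J → ℝ}
    (hstinv : ∀ j, st (st j) = j) (hVst : ∀ j, Vf (st j) = (Vf j)ᴴ)
    (hωst : ∀ j, ω (st j) = -ω j) (A : Matrix N N ℂ) :
    genL Vf ω Aᴴ = (genL Vf ω A)ᴴ := by
  rw [genL, genL, Matrix.conjTranspose_sum, ← Equiv.sum_comp ⟨st, st, hstinv, hstinv⟩]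
  refine Finset.sum_congr rfl fun j _ => ?_
  simp only [Equiv.coe_fn_mk, hVst, hωst, neg_neg, conjTranspose_conjTranspose,
    conjTranspose_sub, conjTranspose_smul, conjTranspose_mul, star_trivial, mul_sub, sub_mul,
    smul_sub]
  abel

theorem carre_grad_conjTranspose {st : J → J} {Vf : J → Matrix N N ℂ}
    (hstinv : ∀ j, st (st j) = j) (hVst : ∀ j, Vf (st j) = (Vf j)ᴴ) (A : Matrix N N ℂ) :
    carre (gradL Vf Aᴴ) = carre (gradL Vf A) := by
  rw [carre, carre, ← Equiv.sum_comp ⟨st, st, hstinv, hstinv⟩]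
  congr 1
  refine Finset.sum_congr rfl fun j _ => ?_
  have h : gradL Vf Aᴴ (st j) = -(gradL Vf A j)ᴴ := by
    simp [gradL_apply, gradD, hVst]
  simp only [Equiv.coe_fn_mk, h]
  simp [add_comm]

theorem genL_one (Vf : J → Matrix N N ℂ) (ω : J → ℝ) : genLin Vf ω 1 = 0 := by
  simp [genLin_apply, genL]

theorem gradL_one (Vf : J → Matrix N N ℂ) : gradL Vf 1 = 0 := by
  ext1 j
  simp [gradL_apply, gradD]

theorem exists_reGnsH_gradL_eq (hN : (Fintype.card N : ℂ) ≠ 0)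
    {Vf : J → Matrix N N ℂ} {ω : J → ℝ}
    (herg : ∀ A : Matrix N N ℂ, genL Vf ω A = 0 → ∃ c : ℂ, A = c • (1 : Matrix N N ℂ))
    {X : Matrix N N ℂ} (hX : tau X = 0) :
    ∃ V : J → Matrix N N ℂ, ∀ B, reGnsH V (gradL Vf B) = reGns X B := by
  have hker : reGns X ∈ (LinearMap.ker (gradL Vf)).dualAnnihilator := by
    rw [Submodule.mem_dualAnnihilator]
    intro B hB
    have hj : ∀ j, Vf j * B - B * Vf j = 0 := fun j =>
      congrFun (LinearMap.mem_ker.1 hB : gradD Vf B = 0) j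
    obtain ⟨c, rfl⟩ := herg B (by
      rw [genL]
      refine Finset.sum_eq_zero fun j _ => ?_
      rw [show B * Vf j - Vf j * B = 0 by rw [← neg_sub, hj j, neg_zero]]
      simp)
    rw [reGns_apply, gns, Matrix.mul_smul, Matrix.mul_one, tau, trace_smul, smul_eq_mul,
      mul_div_assoc, ← tau, tau_conjTranspose, hX]
    simp
  rw [← LinearMap.range_dualMap_eq_dualAnnihilator_ker] at hker
  obtain ⟨f, hf⟩ := hker
  refine ⟨fun j => rieszMatrix (f.comp (LinearMap.single ℝ (fun _ => Matrix N N ℂ) j)),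
    fun B => ?_⟩
  rw [← hf, reGnsH_eq_sum]
  simp only [reGns_rieszMatrix hN, LinearMap.comp_apply, LinearMap.dualMap_apply]
  rw [← map_sum]
  congr 1
  exact LinearMap.sum_single_apply _ _

/-- The matrix `∑ j, (e^{-ω_j} V_j^* V_j + e^{ω_j} V_j V_j^*)` controlling the heat flux. -/
noncomputable def heatWeight (Vf : J → Matrix N N ℂ) (ω : J → ℝ) : Matrix N N ℂ :=
  ∑ j, (Real.exp (-ω j / 2) ^ 2 • ((Vf j)ᴴ * Vf j) + Real.exp (ω j / 2) ^ 2 • (Vf j * (Vf j)ᴴ))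

theorem reGnsH_heatL_le (Vf : J → Matrix N N ℂ) (ω : J → ℝ) {ρ : Matrix N N ℂ}
    (hρ : ρ.PosSemidef) (W : J → Matrix N N ℂ) :
    reGnsH (heatL Vf ω ρ) W ≤ (1 / 2) * reGnsH W (antiL ρ W) + reGns ρ (heatWeight Vf ω) := by
  rw [heatWeight, reGnsH_eq_sum, anti_form_eq, map_sum, Finset.mul_sum, ← Finset.sum_add_distrib]
  refine Finset.sum_le_sum fun j _ => ?_
  rw [heatL_apply]
  generalize Real.exp (-ω j / 2) = a
  generalize Real.exp (ω j / 2) = b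
  generalize Vf j = X
  generalize W j = Y
  have h1 := re_tau_nonneg (hρ.mul_mul_conjTranspose_same (Y - (2 * a) • X))
  have h2 := re_tau_nonneg (hρ.conjTranspose_mul_mul_same (Y + (2 * b) • X))
  have hs : (tau (Y * ρ * Xᴴ)).re = (tau (X * ρ * Yᴴ)).re := by
    rw [← re_tau_conjTranspose]; simp [hρ.isHermitian.eq, Matrix.mul_assoc]
  have hs' : (tau (Yᴴ * ρ * X)).re = (tau (Xᴴ * ρ * Y)).re := by
    rw [← re_tau_conjTranspose]; simp [hρ.isHermitian.eq, Matrix.mul_assoc]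
  simp only [conjTranspose_sub, conjTranspose_add, conjTranspose_smul, star_trivial,
    Matrix.mul_sub, Matrix.sub_mul, Matrix.mul_add, Matrix.add_mul, Matrix.smul_mul,
    Matrix.mul_smul, tau_sub, tau_add, tau_smul, Complex.sub_re, Complex.add_re,
    Complex.real_smul, Complex.re_ofReal_mul, hs, hs'] at h1 h2
  have e1 : reGns (X * ρ) Y = (tau (X * ρ * Yᴴ)).re := by
    rw [reGns_comm, reGns_apply, gns, tau_mul_comm]
  have e2 : reGns (ρ * X) Y = (tau (Xᴴ * ρ * Y)).re := by
    rw [reGns_apply, gns, conjTranspose_mul, hρ.isHermitian.eq]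
  have e3 : reGns ρ (Xᴴ * X) = (tau (X * ρ * Xᴴ)).re := by
    rw [reGns_apply, gns, hρ.isHermitian.eq, ← Matrix.mul_assoc, tau_mul_comm,
      ← Matrix.mul_assoc]
  have e4 : reGns ρ (X * Xᴴ) = (tau (Xᴴ * ρ * X)).re := by
    rw [reGns_apply, gns, hρ.isHermitian.eq, ← Matrix.mul_assoc, tau_mul_comm,
      ← Matrix.mul_assoc]
  rw [LinearMap.map_sub₂, LinearMap.map_smul₂, LinearMap.map_smul₂, map_add, map_smul, map_smul,
    e1, e2, e3, e4]
  simp only [smul_eq_mul]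
  linarith

theorem mul_reGnsH_heatL_le (Vf : J → Matrix N N ℂ) (ω : J → ℝ) {ρ : Matrix N N ℂ}
    (hρ : ρ.PosSemidef) (W : J → Matrix N N ℂ) (a : ℝ) :
    a * reGnsH (heatL Vf ω ρ) W ≤
      (1 / 2) * reGnsH W (antiL ρ W) + a ^ 2 * reGns ρ (heatWeight Vf ω) := by
  rcases eq_or_ne a 0 with rfl | ha
  · have := anti_form_nonneg hρ W
    simpa using this
  · have := mul_le_mul_of_nonneg_left (reGnsH_heatL_le Vf ω hρ (a⁻¹ • W)) (sq_nonneg a)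
    simp only [map_smul, LinearMap.smul_apply, smul_eq_mul] at this
    field_simp at this
    rw [mul_div_cancel_left₀ _ ha] at this
    linarith

end Structure

section Analysis

set_option linter.unusedSectionVars false

theorem exists_integral_curry_of_normed {E : Type*} [NormedAddCommGroup E] [NormedSpace ℝ E]
    [CompleteSpace E] (F : C(ℝ × unitInterval, E)) (a b : ℝ) :
    ∃ G : C(unitInterval, E),
      (∀ (ℓ : E →L[ℝ] ℝ) s, ℓ (G s) = ∫ t in a..b, ℓ (F (t, s))) ∧
      ∀ φ : C(unitInterval, E) →L[ℝ] ℝ, φ G = ∫ t in a..b, φ (F.curry t) := by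
  have hint : IntervalIntegrable (fun t => F.curry t) volume a b :=
    F.curry.continuous.intervalIntegrable a b
  refine ⟨∫ t in a..b, F.curry t, fun ℓ s => ?_, fun φ => ?_⟩
  · exact ((ℓ.comp (ContinuousMap.evalCLM ℝ s)).intervalIntegral_comp_comm hint).symm
  · exact (φ.intervalIntegral_comp_comm hint).symm

theorem hasDerivAt_curry (F F' : C(ℝ × unitInterval, ℝ))
    (hF : ∀ t s, HasDerivAt (fun u => F (u, s)) (F' (t, s)) t)
    (φ : C(unitInterval, ℝ) →L[ℝ] ℝ) (t : ℝ) :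
    HasDerivAt (fun u => φ (F.curry u)) (φ (F'.curry t)) t := by
  have hc : Continuous fun u => φ (F'.curry u) := φ.continuous.comp F'.curry.continuous
  have h : (fun u => φ (F.curry u)) =
      fun u => φ (F.curry 0) + ∫ v in (0:ℝ)..u, φ (F'.curry v) := by
    funext u
    obtain ⟨G, hG, hφ⟩ := exists_integral_curry_of_normed F' 0 u
    rw [← hφ, ← map_add]
    congr 1
    ext s
    have := hG (ContinuousLinearMap.id ℝ ℝ) s
    simp only [ContinuousLinearMap.id_apply] at this
    rw [ContinuousMap.add_apply, this, intervalIntegral.integral_eq_sub_of_hasDerivAt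
      (f := fun u => F (u, s)) (fun v _ => hF v s)
      (Continuous.intervalIntegrable (by fun_prop) _ _)]
    simp
  rw [h]
  exact (intervalIntegral.integral_hasDerivAt_right (hc.intervalIntegrable _ _)
    (hc.stronglyMeasurableAtFilter _ _) hc.continuousAt).const_add _

theorem exists_continuous_solution {P E : Type*} [NormedAddCommGroup P] [NormedSpace ℝ P]
    [FiniteDimensional ℝ P] [NormedAddCommGroup E] [NormedSpace ℝ E] [FiniteDimensional ℝ E]
    (B : P →ₗ[ℝ] E →ₗ[ℝ] E) {ρ : ℝ → P} (hρ : Continuous ρ)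
    (hB : ∀ t, Function.Bijective (B (ρ t))) {V : ℝ → E} (hV : Continuous V) :
    ∃ W : ℝ → E, Continuous W ∧ ∀ t, B (ρ t) (W t) = V t := by
  let Φ : P →ₗ[ℝ] (E →L[ℝ] E) := LinearMap.toContinuousLinearMap.toLinearMap.comp B
  have hΦ : Continuous Φ := Φ.continuous_of_finiteDimensional
  have hunit : ∀ t, IsUnit (Φ (ρ t)) := by
    intro t
    let e := (LinearEquiv.ofBijective _ (hB t)).toContinuousLinearEquiv
    refine ⟨⟨Φ (ρ t), e.symm.toContinuousLinearMap, ?_, ?_⟩, rfl⟩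
    · ext1 x
      exact e.apply_symm_apply x
    · ext1 x
      exact e.symm_apply_apply x
  have : CompleteSpace E := FiniteDimensional.complete ℝ E
  refine ⟨fun t => Ring.inverse (Φ (ρ t)) (V t), ?_, fun t => ?_⟩
  · refine Continuous.clm_apply ?_ hV
    rw [continuous_iff_continuousAt]
    intro t
    obtain ⟨u, hu⟩ := hunit t
    have h := NormedRing.inverse_continuousAt u
    rw [hu] at h
    exact ContinuousAt.comp (f := fun t => Φ (ρ t)) h (hΦ.comp hρ).continuousAt
  · exact congrArg (fun f : E →L[ℝ] E => f (V t)) (Ring.mul_inverse_cancel _ (hunit t))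

variable {N : Type*} [Fintype N] [DecidableEq N] {J : Type*} [Fintype J]

section Norms

open scoped Matrix.Norms.Elementwise MatrixOrder

theorem exists_integral_curry (F : C(ℝ × unitInterval, Matrix N N ℂ)) (a b : ℝ) :
    ∃ G : C(unitInterval, Matrix N N ℂ),
      (∀ (ℓ : Matrix N N ℂ →L[ℝ] ℝ) s, ℓ (G s) = ∫ t in a..b, ℓ (F (t, s))) ∧
      ∀ φ : C(unitInterval, Matrix N N ℂ) →L[ℝ] ℝ, φ G = ∫ t in a..b, φ (F.curry t) :=
  exists_integral_curry_of_normed F a b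

theorem exists_integral_curry_pi (F : C(ℝ × unitInterval, J → Matrix N N ℂ)) (a b : ℝ) :
    ∃ G : C(unitInterval, J → Matrix N N ℂ),
      (∀ (ℓ : (J → Matrix N N ℂ) →L[ℝ] ℝ) s, ℓ (G s) = ∫ t in a..b, ℓ (F (t, s))) ∧
      ∀ φ : C(unitInterval, J → Matrix N N ℂ) →L[ℝ] ℝ, φ G = ∫ t in a..b, φ (F.curry t) :=
  exists_integral_curry_of_normed F a b

theorem isCompact_density :
    IsCompact {ρ : Matrix N N ℂ | ρ.PosSemidef ∧ tau ρ = 1} := by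
  have hK : IsCompact {B : Matrix N N ℂ | tau (Bᴴ * B) = 1} := by
    refine Metric.isCompact_of_isClosed_isBounded ?_ ?_
    · refine isClosed_eq ?_ continuous_const
      unfold tau
      fun_prop
    · refine isBounded_iff_forall_norm_le.2 ⟨Fintype.card N + 1, fun B hB => ?_⟩
      rw [Matrix.norm_le_iff (by positivity)]
      intro i k
      have hN := card_ne_zero_of_tau hB
      have h1 : ∑ i, ∑ k, ‖B i k‖ ^ 2 = Fintype.card N := by
        have h2 : gns B B = 1 := hB
        rw [gns_eq_sum, div_eq_one_iff_eq hN] at h2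
        have h3 : ((∑ i, ∑ k, ‖B i k‖ ^ 2 : ℝ) : ℂ) = (Fintype.card N : ℝ) := by
          push_cast
          rw [← h2]
          refine Finset.sum_congr rfl fun i _ => Finset.sum_congr rfl fun k _ => ?_
          rw [← Complex.conj_mul']
          rfl
        exact_mod_cast h3
      have h4 : ‖B i k‖ ^ 2 ≤ Fintype.card N := by
        rw [← h1]
        exact (Finset.single_le_sum (f := fun k => ‖B i k‖ ^ 2) (fun _ _ => by positivity)
          (Finset.mem_univ k)).trans
          (Finset.single_le_sum (f := fun i => ∑ k, ‖B i k‖ ^ 2) (fun _ _ => by positivity)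
          (Finset.mem_univ i))
      nlinarith [norm_nonneg (B i k)]
  convert hK.image (f := fun B : Matrix N N ℂ => Bᴴ * B) (by fun_prop) using 1
  ext ρ
  constructor
  · rintro ⟨hρ, htr⟩
    obtain ⟨B, rfl⟩ := CStarAlgebra.nonneg_iff_eq_star_mul_self.1 hρ.nonneg
    exact ⟨B, htr, rfl⟩
  · rintro ⟨B, hB, rfl⟩
    exact ⟨Matrix.posSemidef_conjTranspose_mul_self B, hB⟩

theorem exists_continuous_antiL_eq (hN : (Fintype.card N : ℂ) ≠ 0) {ρ : ℝ → Matrix N N ℂ}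
    (hρ : Continuous ρ) (hpos : ∀ t, (ρ t).PosDef) {V : ℝ → J → Matrix N N ℂ}
    (hV : Continuous V) :
    ∃ W : ℝ → J → Matrix N N ℂ, Continuous W ∧ ∀ t, antiL (ρ t) (W t) = V t :=
  exists_continuous_solution (P := Matrix N N ℂ) (E := J → Matrix N N ℂ) antiL hρ
    (fun t => ⟨antiL_injective (hpos t) hN, antiL_surjective (hpos t) hN⟩) hV

end Norms

end Analysis

section Separation

set_option linter.unusedSectionVars false

variable {N : Type*} [Fintype N] [DecidableEq N] {J : Type*} [Fintype J]

theorem anti_form_convex {ρ : Matrix N N ℂ} (hρ : ρ.PosSemidef) (Y Z : J → Matrix N N ℂ)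
    {a b : ℝ} (ha : 0 ≤ a) (hb : 0 ≤ b) (hab : a + b = 1) :
    reGnsH (a • Y + b • Z) (antiL ρ (a • Y + b • Z)) ≤
      a * reGnsH Y (antiL ρ Y) + b * reGnsH Z (antiL ρ Z) := by
  have h := two_anti_form_le hρ Y Z
  have h' : reGnsH Z (antiL ρ Y) = reGnsH Y (antiL ρ Z) := by
    rw [← reGnsH_opAnti_left ρ hρ.isHermitian, reGnsH_comm]
  simp only [map_add, map_smul, LinearMap.add_apply, LinearMap.smul_apply, smul_eq_mul, h']
  obtain rfl : b = 1 - a := by linarith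
  nlinarith [mul_le_mul_of_nonneg_left h (mul_nonneg ha hb)]

theorem continuous_reGns {X : Type*} [TopologicalSpace X] {f g : X → Matrix N N ℂ}
    (hf : Continuous f) (hg : Continuous g) : Continuous fun x => reGns (f x) (g x) := by
  simp only [reGns_apply, gns_eq_sum]
  fun_prop

theorem continuous_reGnsH {X : Type*} [TopologicalSpace X] {f g : X → J → Matrix N N ℂ}
    (hf : Continuous f) (hg : Continuous g) : Continuous fun x => reGnsH (f x) (g x) := by
  simp only [reGnsH_eq_sum]
  exact continuous_finsetSum _ fun j _ => continuous_reGns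
    ((continuous_apply j).comp hf) ((continuous_apply j).comp hg)

theorem continuous_antiL {X : Type*} [TopologicalSpace X] {f : X → Matrix N N ℂ}
    {g : X → J → Matrix N N ℂ} (hf : Continuous f) (hg : Continuous g) :
    Continuous fun x => antiL (f x) (g x) := by
  simp only [antiL_apply]
  unfold opAnti
  fun_prop

variable (N J) in
/-- Pairs `(B, Y)` of curves with `⟨ρ, B⟩ + ½⟨Y, [ρ]_anti Y⟩ < 0` for all density matrices `ρ`. -/
def strictSubsolutions :
    Set (C(unitInterval, Matrix N N ℂ) × C(unitInterval, J → Matrix N N ℂ)) :=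
  {x | ∀ s, ∀ ρ : Matrix N N ℂ, ρ.PosSemidef → tau ρ = 1 →
    reGns ρ (x.1 s) + (1 / 2) * reGnsH (x.2 s) (antiL ρ (x.2 s)) < 0}

theorem mem_strictSubsolutions {B : C(unitInterval, Matrix N N ℂ)}
    {Y : C(unitInterval, J → Matrix N N ℂ)} :
    (B, Y) ∈ strictSubsolutions N J ↔ ∀ s, ∀ ρ : Matrix N N ℂ, ρ.PosSemidef → tau ρ = 1 →
      reGns ρ (B s) + (1 / 2) * reGnsH (Y s) (antiL ρ (Y s)) < 0 := Iff.rfl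

theorem isOpen_strictSubsolutions : IsOpen (strictSubsolutions N J) := by
  rw [isOpen_iff_eventually]
  intro x hx
  have hK : IsCompact ((Set.univ : Set unitInterval) ×ˢ
      {ρ : Matrix N N ℂ | ρ.PosSemidef ∧ tau ρ = 1}) := isCompact_univ.prod isCompact_density
  have hcont : Continuous fun z : (C(unitInterval, Matrix N N ℂ) ×
      C(unitInterval, J → Matrix N N ℂ)) × (unitInterval × Matrix N N ℂ) =>
      reGns z.2.2 (z.1.1 z.2.1) + (1 / 2) * reGnsH (z.1.2 z.2.1) (antiL z.2.2 (z.1.2 z.2.1)) := by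
    refine Continuous.add ?_ (continuous_const.mul ?_)
    · exact continuous_reGns continuous_snd.snd (continuous_fst.fst.eval continuous_snd.fst)
    · have h := continuous_fst.snd.eval (continuous_snd.fst)
        (f := fun z : (C(unitInterval, Matrix N N ℂ) ×
      C(unitInterval, J → Matrix N N ℂ)) × (unitInterval × Matrix N N ℂ) => z.1.2)
      exact continuous_reGnsH h (continuous_antiL continuous_snd.snd h)
  have := hK.eventually_forall_of_forall_eventually (x₀ := x)
    (P := fun x p => reGns p.2 (x.1 p.1) + (1 / 2) * reGnsH (x.2 p.1) (antiL p.2 (x.2 p.1)) < 0)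
    fun p hp => hcont.continuousAt.eventually_lt continuousAt_const (hx p.1 p.2 hp.2.1 hp.2.2)
  filter_upwards [this] with y hy s ρ hρ htr
  exact hy (s, ρ) ⟨trivial, hρ, htr⟩

theorem isHJBanti_hermitianPart {ε : ℝ} {st : J → J} {Vf : J → Matrix N N ℂ} {ω : J → ℝ}
    (hstinv : ∀ j, st (st j) = j) (hVst : ∀ j, Vf (st j) = (Vf j)ᴴ)
    (hωst : ∀ j, ω (st j) = -ω j) {A A' : ℝ → Matrix N N ℂ} (hA' : Continuous A')
    (hA : ∀ t i k, HasDerivAt (fun s => A s i k) (A' t i k) t)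
    (hsub : ∀ t ∈ Set.Icc (0:ℝ) 1, ∀ ρ : Matrix N N ℂ, ρ.PosSemidef → tau ρ = 1 →
      reGns ρ (A' t + ε • genLin Vf ω (A t)) +
        (1 / 2) * reGnsH (gradL Vf (A t)) (antiL ρ (gradL Vf (A t))) ≤ 0) :
    IsHJBanti Vf ω ε (fun t => (1 / 2 : ℝ) • (A t + (A t)ᴴ))
      (fun t => (1 / 2 : ℝ) • (A' t + (A' t)ᴴ)) := by
  refine ⟨fun t _ => ?_, fun t _ i k => ?_, fun i k => ?_, fun t ht ρ hρ htr => ?_⟩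
  · simp [IsHermitian, add_comm]
  · exact ((hA t i k).add (hA t k i).star).const_smul (1 / 2 : ℝ)
  · have h : ∀ i k, Continuous fun t => A' t i k := fun i k => hA'.matrix_elem i k
    exact (((h i k).add (h k i).star).const_smul (1 / 2 : ℝ)).continuousOn
  · have h := hsub t ht ρ hρ htr
    rw [re_gns_of_isHermitian hρ.isHermitian, ← reGnsH_apply, ← antiL_apply, ← gradL_apply,
      ← genLin_apply]
    have hL : genLin Vf ω (A t)ᴴ = (genLin Vf ω (A t))ᴴ :=
      genL_conjTranspose hstinv hVst hωst (A t)
    have hG : reGnsH (gradL Vf (A t)ᴴ) (antiL ρ (gradL Vf (A t)ᴴ)) =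
        reGnsH (gradL Vf (A t)) (antiL ρ (gradL Vf (A t))) := by
      rw [← reGns_carre ρ hρ.isHermitian, carre_grad_conjTranspose hstinv hVst,
        reGns_carre ρ hρ.isHermitian]
    have hstar : ∀ X : Matrix N N ℂ, reGns ρ Xᴴ = reGns ρ X := fun X => by
      rw [← reGns_conjTranspose, hρ.isHermitian.eq]
    have hQ := anti_form_convex hρ (gradL Vf (A t)) (gradL Vf (A t)ᴴ)
      (a := 1 / 2) (b := 1 / 2) (by norm_num) (by norm_num) (by norm_num)
    rw [hG] at hQ
    have hgrad : gradL Vf ((1 / 2 : ℝ) • (A t + (A t)ᴴ)) =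
        (1 / 2 : ℝ) • gradL Vf (A t) + (1 / 2 : ℝ) • gradL Vf (A t)ᴴ := by
      rw [map_smul, map_add, smul_add]
    rw [← hgrad] at hQ
    generalize reGnsH (gradL Vf ((1 / 2 : ℝ) • (A t + (A t)ᴴ)))
      (antiL ρ (gradL Vf ((1 / 2 : ℝ) • (A t + (A t)ᴴ)))) = q at hQ ⊢
    simp only [map_add, map_smul, smul_eq_mul, hL, hstar] at h ⊢
    linarith

/-- The data `((A' + ε L A, ∇ A), ⟨ρ₁, A(1)⟩ - ⟨ρ₀, A(0)⟩)` for `C¹` curves `A`. -/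
def hjSubmodule (ε : ℝ) (Vf : J → Matrix N N ℂ) (ω : J → ℝ) (ρ₀ ρ₁ : Matrix N N ℂ) :
    Submodule ℝ ((C(unitInterval, Matrix N N ℂ) × C(unitInterval, J → Matrix N N ℂ)) × ℝ) where
  carrier := {x | ∃ A A' : ℝ → Matrix N N ℂ, Continuous A' ∧
    (∀ t i k, HasDerivAt (fun s => A s i k) (A' t i k) t) ∧
    (∀ s : unitInterval, x.1.1 s = A' s + ε • genLin Vf ω (A s)) ∧
    (∀ s : unitInterval, x.1.2 s = gradL Vf (A s)) ∧
    x.2 = reGns ρ₁ (A 1) - reGns ρ₀ (A 0)}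
  zero_mem' := ⟨0, 0, continuous_const, fun t i k => hasDerivAt_const _ _, by simp, by simp,
    by simp⟩
  add_mem' := by
    rintro x y ⟨A, A', hc, hd, h1, h2, h3⟩ ⟨B, B', hc', hd', h1', h2', h3'⟩
    refine ⟨A + B, A' + B', hc.add hc', fun t i k => (hd t i k).add (hd' t i k),
      fun s => ?_, fun s => ?_, ?_⟩
    · simp only [Prod.fst_add, ContinuousMap.add_apply, h1, h1', Pi.add_apply, map_add, smul_add]
      abel
    · simp only [Prod.fst_add, Prod.snd_add, ContinuousMap.add_apply, h2, h2', Pi.add_apply,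
        map_add]
    · simp only [Prod.snd_add, h3, h3', Pi.add_apply, map_add]
      ring
  smul_mem' := by
    rintro c x ⟨A, A', hc, hd, h1, h2, h3⟩
    refine ⟨c • A, c • A', hc.const_smul c, fun t i k => (hd t i k).const_smul c,
      fun s => ?_, fun s => ?_, ?_⟩
    · simp only [Prod.smul_fst, ContinuousMap.smul_apply, h1, Pi.smul_apply, map_smul,
        smul_add, smul_comm c ε]
    · simp only [Prod.smul_fst, Prod.smul_snd, ContinuousMap.smul_apply, h2, Pi.smul_apply,
        map_smul]
    · simp only [Prod.smul_snd, h3, Pi.smul_apply, map_smul, smul_sub]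

theorem mem_hjSubmodule {ε : ℝ} {Vf : J → Matrix N N ℂ} {ω : J → ℝ} {ρ₀ ρ₁ : Matrix N N ℂ}
    {B : C(unitInterval, Matrix N N ℂ)} {Y : C(unitInterval, J → Matrix N N ℂ)} {r : ℝ} :
    ((B, Y), r) ∈ hjSubmodule ε Vf ω ρ₀ ρ₁ ↔ ∃ A A' : ℝ → Matrix N N ℂ, Continuous A' ∧
      (∀ t i k, HasDerivAt (fun s => A s i k) (A' t i k) t) ∧
      (∀ s : unitInterval, B s = A' s + ε • genLin Vf ω (A s)) ∧
      (∀ s : unitInterval, Y s = gradL Vf (A s)) ∧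
      r = reGns ρ₁ (A 1) - reGns ρ₀ (A 0) := Iff.rfl

theorem convex_strictSubsolutions : Convex ℝ (strictSubsolutions N J) := by
  rintro ⟨B, Y⟩ hx ⟨B', Y'⟩ hy a b ha hb hab s ρ hρ htr
  have h1 : reGns ρ (B s) + (1 / 2) * reGnsH (Y s) (antiL ρ (Y s)) < 0 := hx s ρ hρ htr
  have h2 : reGns ρ (B' s) + (1 / 2) * reGnsH (Y' s) (antiL ρ (Y' s)) < 0 := hy s ρ hρ htr
  have hQ := anti_form_convex hρ (Y s) (Y' s) ha hb hab
  change reGns ρ (a • B s + b • B' s) +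
    (1 / 2) * reGnsH (a • Y s + b • Y' s) (antiL ρ (a • Y s + b • Y' s)) < 0
  rw [map_add, map_smul, map_smul, smul_eq_mul, smul_eq_mul]
  rcases eq_or_lt_of_le ha with rfl | ha'
  · obtain rfl : b = 1 := by linarith
    linarith
  · nlinarith

theorem exists_functional_eq_on_of_forall_le {E : Type*} [TopologicalSpace E] [AddCommGroup E]
    [Module ℝ E] [IsTopologicalAddGroup E] [ContinuousSMul ℝ E] {P : Set E} (hPc : Convex ℝ P)
    (hPo : IsOpen P) (T : Submodule ℝ (E × ℝ)) {D : ℝ}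
    (hPT : ∀ x ∈ P, ∀ r, (x, r) ∈ T → r ≤ D) {p : E} (hp : p ∈ P) {r₀ : ℝ}
    (hpT : (p, r₀) ∈ T) :
    ∃ Φ : E →L[ℝ] ℝ, (∀ x r, (x, r) ∈ T → Φ x = r) ∧ ∀ x ∈ P, Φ x ≤ D := by
  have hdisj : Disjoint (P ×ˢ Set.Ioi D) (T : Set (E × ℝ)) := by
    rw [Set.disjoint_left]
    rintro ⟨x, r⟩ ⟨hx, hr⟩ hT
    exact (hPT x hx r hT).not_gt hr
  obtain ⟨f, u, hfS, hfT⟩ := geometric_hahn_banach_open (hPc.prod (convex_Ioi D))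
    (hPo.prod isOpen_Ioi) T.convex hdisj
  have hf0 : ∀ x ∈ T, f x = 0 := by
    intro x hx
    by_contra hne
    have := hfT ((((u - 1) / f x) : ℝ) • x) (T.smul_mem _ hx)
    rw [map_smul, smul_eq_mul, div_mul_cancel₀ _ hne] at this
    linarith
  have hu : u ≤ 0 := by simpa using hfT 0 T.zero_mem
  set φ := f.comp (ContinuousLinearMap.inl ℝ E ℝ) with hφ
  set c := f (0, 1) with hc
  have hsplit : ∀ x r, f (x, r) = φ x + r * c := by
    intro x r
    have : (x, r) = (x, (0 : ℝ)) + r • ((0, 1) : E × ℝ) := by simp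
    rw [this, map_add, map_smul]
    rfl
  have hr₀ := hPT p hp r₀ hpT
  have hcneg : c < 0 := by
    have h1 := hf0 _ hpT
    have h2 := hfS (p, D + 1) ⟨hp, by simp⟩
    rw [hsplit] at h1 h2
    nlinarith
  refine ⟨(-c)⁻¹ • φ, fun x r hT => ?_, fun x hx => le_of_forall_pos_le_add fun δ hδ => ?_⟩
  · have := hf0 _ hT
    rw [hsplit] at this
    rw [_root_.smul_apply, smul_eq_mul, inv_mul_eq_iff_eq_mul₀ (by linarith)]
    linarith
  · have := hfS (x, D + δ) ⟨hx, by simpa using hδ⟩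
    rw [hsplit] at this
    rw [_root_.smul_apply, smul_eq_mul, inv_mul_le_iff₀ (by linarith)]
    linarith

theorem reGns_one {ρ : Matrix N N ℂ} (h : tau ρ = 1) : reGns ρ 1 = 1 := by
  rw [reGns_apply, gns, Matrix.mul_one, tau_conjTranspose, h]
  simp

theorem exists_dual_functionals {ε : ℝ} {st : J → J} {Vf : J → Matrix N N ℂ} {ω : J → ℝ}
    (hstinv : ∀ j, st (st j) = j) (hVst : ∀ j, Vf (st j) = (Vf j)ᴴ)
    (hωst : ∀ j, ω (st j) = -ω j) {ρ₀ ρ₁ : Matrix N N ℂ} (h₀ : ρ₀.IsHermitian)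
    (h₁ : ρ₁.IsHermitian) (h₁tr : tau ρ₁ = 1) {D : ℝ}
    (hD : ∀ A A', IsHJBanti Vf ω ε A A' → (tau (A 1 * ρ₁ - A 0 * ρ₀)).re ≤ D) :
    ∃ (φ : C(unitInterval, Matrix N N ℂ) →L[ℝ] ℝ) (ψ : C(unitInterval, J → Matrix N N ℂ) →L[ℝ] ℝ),
      (∀ A A' : ℝ → Matrix N N ℂ, Continuous A' →
        (∀ t i k, HasDerivAt (fun s => A s i k) (A' t i k) t) → ∀ B Y,
        (∀ s : unitInterval, B s = A' s + ε • genLin Vf ω (A s)) →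
        (∀ s : unitInterval, Y s = gradL Vf (A s)) →
        φ B + ψ Y = reGns ρ₁ (A 1) - reGns ρ₀ (A 0)) ∧
      ∀ B Y, (∀ s, ∀ ρ : Matrix N N ℂ, ρ.PosSemidef → tau ρ = 1 →
        reGns ρ (B s) + (1 / 2) * reGnsH (Y s) (antiL ρ (Y s)) ≤ 0) → φ B + ψ Y ≤ D := by
  have hJ : ∀ x ∈ strictSubsolutions N J, ∀ r, (x, r) ∈ hjSubmodule ε Vf ω ρ₀ ρ₁ → r ≤ D := by
    rintro ⟨B, Y⟩ hx r hT
    obtain ⟨A, A', hc, hd, h1, h2, rfl⟩ := mem_hjSubmodule.1 hT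
    have hJ := isHJBanti_hermitianPart (ε := ε) hstinv hVst hωst hc hd fun t ht ρ hρ htr => by
      have := hx ⟨t, ht⟩ ρ hρ htr
      rw [h1, h2] at this
      exact this.le
    have := hD _ _ hJ
    rw [tau_sub, Complex.sub_re, re_gns_of_isHermitian h₁, re_gns_of_isHermitian h₀] at this
    simp only [map_smul, map_add, ← reGns_conjTranspose, h₁.eq, h₀.eq, smul_eq_mul] at this
    linarith
  have hT1 : (((ContinuousMap.const _ (-1)), 0), -1) ∈ hjSubmodule ε Vf ω ρ₀ ρ₁ := by
    refine mem_hjSubmodule.2 ⟨fun t => -(t • 1), fun _ => -1, continuous_const, fun t i k => ?_,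
      fun s => ?_, fun s => ?_, ?_⟩
    · have := ((hasDerivAt_id t).smul_const ((1 : Matrix N N ℂ) i k)).neg
      rw [one_smul] at this
      exact this
    · simp [genL_one]
    · simp [gradL_one]
    · simp [reGns_one h₁tr]
  have hP1 : (ContinuousMap.const _ (-1), 0) ∈ strictSubsolutions N J :=
    mem_strictSubsolutions.2 fun s ρ _ htr => by simp [reGns_one htr]
  have key := @exists_functional_eq_on_of_forall_le
    (C(unitInterval, Matrix N N ℂ) × C(unitInterval, J → Matrix N N ℂ)) _ _ _ _ _
    (strictSubsolutions N J)
  obtain ⟨Φ, hΦT, hΦP⟩ := key convex_strictSubsolutions isOpen_strictSubsolutions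
    (hjSubmodule ε Vf ω ρ₀ ρ₁) hJ hP1 hT1
  have hsplit : ∀ B Y, Φ.comp (ContinuousLinearMap.inl ℝ _ _) B +
      Φ.comp (ContinuousLinearMap.inr ℝ _ _) Y = Φ (B, Y) := by
    intro B Y
    rw [ContinuousLinearMap.comp_apply, ContinuousLinearMap.comp_apply, ← map_add]
    simp
  refine ⟨Φ.comp (ContinuousLinearMap.inl ℝ _ _), Φ.comp (ContinuousLinearMap.inr ℝ _ _),
    fun A A' hA' hd B Y hB hY => ?_, fun B Y hBY => ?_⟩
  · rw [hsplit]
    exact hΦT _ _ (mem_hjSubmodule.2 ⟨A, A', hA', hd, hB, hY, rfl⟩)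
  · rw [hsplit]
    have h1 : Φ (ContinuousMap.const _ (-1), 0) = -1 := hΦT _ _ hT1
    refine le_of_forall_pos_le_add fun δ hδ => ?_
    have h2 := hΦP ((B, Y) + δ • (ContinuousMap.const _ (-1), 0)) fun s ρ hρ htr => by
      have := hBY s ρ hρ htr
      simp only [Prod.fst_add, Prod.snd_add, Prod.smul_fst, Prod.smul_snd,
        ContinuousMap.add_apply, ContinuousMap.smul_apply, ContinuousMap.const_apply,
        ContinuousMap.zero_apply, smul_zero, add_zero]
      rw [map_add, map_smul, map_neg, reGns_one htr, smul_eq_mul]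
      linarith
    rw [map_add, map_smul, h1, smul_eq_mul] at h2
    linarith

end Separation

section Moments

set_option linter.unusedSectionVars false

/-- The curve `s ↦ f s • X`, as a continuous linear function of `f`. -/
noncomputable def curveSMul {E : Type*} [AddCommGroup E] [Module ℝ E] [TopologicalSpace E]
    [IsTopologicalAddGroup E] [ContinuousSMul ℝ E] (X : E) :
    C(unitInterval, ℝ) →L[ℝ] C(unitInterval, E) :=
  ContinuousLinearMap.compLeftContinuous ℝ unitInterval ((1 : ℝ →L[ℝ] ℝ).smulRight X)

theorem curveSMul_apply {E : Type*} [AddCommGroup E] [Module ℝ E] [TopologicalSpace E]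
    [IsTopologicalAddGroup E] [ContinuousSMul ℝ E] (X : E) (f : C(unitInterval, ℝ))
    (s : unitInterval) : curveSMul X f s = f s • X := rfl

theorem curveSMul_add {E : Type*} [AddCommGroup E] [Module ℝ E] [TopologicalSpace E]
    [IsTopologicalAddGroup E] [ContinuousSMul ℝ E] (X Y : E) (f : C(unitInterval, ℝ)) :
    curveSMul (X + Y) f = curveSMul X f + curveSMul Y f :=
  ContinuousMap.ext fun s => smul_add (f s) X Y

theorem curveSMul_smul {E : Type*} [AddCommGroup E] [Module ℝ E] [TopologicalSpace E]
    [IsTopologicalAddGroup E] [ContinuousSMul ℝ E] (r : ℝ) (X : E) (f : C(unitInterval, ℝ)) :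
    curveSMul (r • X) f = r • curveSMul X f :=
  ContinuousMap.ext fun s => smul_comm (f s) r X

variable {N : Type*} [Fintype N] [DecidableEq N] {J : Type*} [Fintype J]

/-- The matrix representing `X ↦ φ (f • X)` through the real trace pairing. -/
noncomputable def moment (φ : C(unitInterval, Matrix N N ℂ) →L[ℝ] ℝ) (f : C(unitInterval, ℝ)) :
    Matrix N N ℂ :=
  rieszMatrix
    { toFun := fun X => φ (curveSMul X f)
      map_add' := fun X Y => by rw [curveSMul_add, map_add]
      map_smul' := fun r X => by rw [curveSMul_smul, map_smul]; rfl }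

theorem reGns_moment (hN : (Fintype.card N : ℂ) ≠ 0)
    (φ : C(unitInterval, Matrix N N ℂ) →L[ℝ] ℝ) (f : C(unitInterval, ℝ)) (X : Matrix N N ℂ) :
    reGns (moment φ f) X = φ (curveSMul X f) :=
  reGns_rieszMatrix hN _ X

theorem moment_apply (φ : C(unitInterval, Matrix N N ℂ) →L[ℝ] ℝ) (f : C(unitInterval, ℝ))
    (i k : N) :
    moment φ f i k = (Fintype.card N : ℂ) * (((φ.comp (curveSMul (Matrix.single i k 1))) f : ℝ) +
      Complex.I * ((φ.comp (curveSMul (Matrix.single i k Complex.I))) f : ℝ)) := rfl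

theorem hasDerivAt_moment (φ : C(unitInterval, Matrix N N ℂ) →L[ℝ] ℝ)
    (F F' : C(ℝ × unitInterval, ℝ)) (hF : ∀ t s, HasDerivAt (fun u => F (u, s)) (F' (t, s)) t)
    (t : ℝ) (i k : N) :
    HasDerivAt (fun u => moment φ (F.curry u) i k) (moment φ (F'.curry t) i k) t := by
  simp only [moment_apply]
  exact (((hasDerivAt_curry F F' hF _ t).ofReal_comp).add
    (((hasDerivAt_curry F F' hF _ t).ofReal_comp).const_mul _)).const_mul _

theorem continuous_moment (φ : C(unitInterval, Matrix N N ℂ) →L[ℝ] ℝ)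
    (F : C(ℝ × unitInterval, ℝ)) : Continuous fun u => moment φ (F.curry u) := by
  refine continuous_matrix fun i k => ?_
  simp only [moment_apply]
  have h : ∀ χ : C(unitInterval, ℝ) →L[ℝ] ℝ, Continuous fun u => ((χ (F.curry u) : ℝ) : ℂ) :=
    fun χ => Complex.continuous_ofReal.comp (χ.continuous.comp F.curry.continuous)
  exact continuous_const.mul ((h _).add (continuous_const.mul (h _)))

/-- The family of matrices representing `Y ↦ ψ (f • Y)` through the real trace pairing. -/
noncomputable def momentH (ψ : C(unitInterval, J → Matrix N N ℂ) →L[ℝ] ℝ)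
    (f : C(unitInterval, ℝ)) : J → Matrix N N ℂ :=
  fun j => moment (ψ.comp (ContinuousLinearMap.compLeftContinuous ℝ unitInterval
    (ContinuousLinearMap.single ℝ (fun _ : J => Matrix N N ℂ) j))) f

theorem reGnsH_momentH (hN : (Fintype.card N : ℂ) ≠ 0)
    (ψ : C(unitInterval, J → Matrix N N ℂ) →L[ℝ] ℝ) (f : C(unitInterval, ℝ))
    (Y : J → Matrix N N ℂ) :
    reGnsH (momentH ψ f) Y = ψ (curveSMul Y f) := by
  rw [reGnsH_eq_sum]
  simp only [momentH, reGns_moment hN, ContinuousLinearMap.comp_apply]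
  rw [← map_sum]
  congr 1
  refine ContinuousMap.ext fun s => ?_
  rw [ContinuousMap.sum_apply]
  exact Finset.univ_sum_single (f s • Y)

theorem continuous_momentH (ψ : C(unitInterval, J → Matrix N N ℂ) →L[ℝ] ℝ)
    (F : C(ℝ × unitInterval, ℝ)) : Continuous fun u => momentH ψ (F.curry u) :=
  continuous_pi fun _ => continuous_moment _ F

end Moments

theorem exists_smooth_step : ∃ S g g' : ℝ → ℝ, Continuous g' ∧ (∀ x, HasDerivAt S (g x) x) ∧
    (∀ x, HasDerivAt g (g' x) x) ∧ (∀ x, 0 ≤ g x) ∧ (∀ x, 0 ≤ S x) ∧ (∀ x, S x ≤ 1) ∧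
    (∀ x ≤ 0, S x = 0) ∧ (∀ x, 1 ≤ x → S x = 1) ∧ (∀ x ≤ 0, g x = 0) ∧
    ∀ x, 1 ≤ x → g x = 0 := by
  have hS : ContDiff ℝ 2 Real.smoothTransition := Real.smoothTransition.contDiff
  have hg : ContDiff ℝ 1 (deriv Real.smoothTransition) := hS.deriv'
  have hg' : Continuous (deriv (deriv Real.smoothTransition)) := hg.continuous_deriv le_rfl
  refine ⟨Real.smoothTransition, deriv Real.smoothTransition, deriv (deriv Real.smoothTransition),
    hg', fun x => (hS.differentiable (by simp) x).hasDerivAt,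
    fun x => (hg.differentiable (by simp) x).hasDerivAt,
    fun x => Real.smoothTransition.monotone.deriv_nonneg, Real.smoothTransition.nonneg,
    Real.smoothTransition.le_one, fun x hx => Real.smoothTransition.zero_of_nonpos hx,
    fun x hx => Real.smoothTransition.one_of_one_le hx, fun x hx => ?_, fun x hx => ?_⟩
  · refine IsLocalMin.deriv_eq_zero (.of_forall fun y => ?_)
    rw [Real.smoothTransition.zero_of_nonpos hx]
    exact Real.smoothTransition.nonneg y
  · refine IsLocalMax.deriv_eq_zero (.of_forall fun y => ?_)
    rw [Real.smoothTransition.one_of_one_le hx]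
    exact Real.smoothTransition.le_one y

section DualPair

set_option linter.unusedSectionVars false

variable {N : Type*} [Fintype N] [DecidableEq N] {J : Type*} [Fintype J]

/-- A pair of functionals `(φ, ψ)` playing the role of a measure-valued solution `(ρ, V)` of the
continuity equation from `ρ₀` to `ρ₁` with action at most `D`. -/
structure IsDualPair (ε : ℝ) (Vf : J → Matrix N N ℂ) (ω : J → ℝ) (ρ₀ ρ₁ : Matrix N N ℂ) (D : ℝ)
    (φ : C(unitInterval, Matrix N N ℂ) →L[ℝ] ℝ)
    (ψ : C(unitInterval, J → Matrix N N ℂ) →L[ℝ] ℝ) : Prop where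
  eq_of_hasDerivAt : ∀ A A' : ℝ → Matrix N N ℂ, Continuous A' →
    (∀ t i k, HasDerivAt (fun s => A s i k) (A' t i k) t) → ∀ B Y,
    (∀ s : unitInterval, B s = A' s + ε • genLin Vf ω (A s)) →
    (∀ s : unitInterval, Y s = gradL Vf (A s)) →
    φ B + ψ Y = reGns ρ₁ (A 1) - reGns ρ₀ (A 0)
  le_of_forall_le : ∀ B Y, (∀ s, ∀ ρ : Matrix N N ℂ, ρ.PosSemidef → tau ρ = 1 →
    reGns ρ (B s) + (1 / 2) * reGnsH (Y s) (antiL ρ (Y s)) ≤ 0) → φ B + ψ Y ≤ D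

variable {ε : ℝ} {Vf : J → Matrix N N ℂ} {ω : J → ℝ} {ρ₀ ρ₁ : Matrix N N ℂ} {D : ℝ}
  {φ : C(unitInterval, Matrix N N ℂ) →L[ℝ] ℝ} {ψ : C(unitInterval, J → Matrix N N ℂ) →L[ℝ] ℝ}

theorem IsDualPair.posSemidef_moment (h : IsDualPair ε Vf ω ρ₀ ρ₁ D φ ψ)
    (hN : (Fintype.card N : ℂ) ≠ 0) {f : C(unitInterval, ℝ)} (hf : ∀ s, 0 ≤ f s) :
    (moment φ f).PosSemidef := by
  refine posSemidef_of_reGns hN fun X hX => ?_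
  rw [reGns_moment hN]
  by_contra! hlt
  obtain ⟨n, hn⟩ := exists_nat_gt (D / φ (curveSMul X f))
  have := h.le_of_forall_le ((n : ℝ) • curveSMul X f) 0 fun s ρ hρ _ => by
    have hs : ((n : ℝ) • curveSMul X f) s = ((n : ℝ) * f s) • X := by
      rw [ContinuousMap.smul_apply, curveSMul_apply, smul_smul]
    rw [hs, map_smul, smul_eq_mul, ContinuousMap.zero_apply, map_zero, LinearMap.zero_apply]
    have := mul_nonneg (Nat.cast_nonneg (α := ℝ) n) (hf s)
    nlinarith [hX ρ hρ]
  rw [map_smul, map_zero, smul_eq_mul, add_zero] at this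
  rw [div_lt_iff₀ hlt] at hn
  linarith

theorem IsDualPair.moment_eq (h : IsDualPair ε Vf ω ρ₀ ρ₁ D φ ψ)
    (hN : (Fintype.card N : ℂ) ≠ 0) {a a' : ℝ → ℝ} (ha' : Continuous a')
    (ha : ∀ s, HasDerivAt a (a' s) s) {f f' : C(unitInterval, ℝ)} (hf : ∀ s, f s = a s)
    (hf' : ∀ s, f' s = a' s) (X : Matrix N N ℂ) :
    reGns (moment φ f') X + ε * reGns (moment φ f) (genLin Vf ω X) +
      reGnsH (momentH ψ f) (gradL Vf X) = a 1 * reGns ρ₁ X - a 0 * reGns ρ₀ X := by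
  have := h.eq_of_hasDerivAt (fun s => a s • X) (fun s => a' s • X) (ha'.smul continuous_const)
    (fun t i k => (ha t).smul_const (X i k))
    (curveSMul X f' + ε • curveSMul (genLin Vf ω X) f) (curveSMul (gradL Vf X) f)
    (fun s => by
      rw [ContinuousMap.add_apply, ContinuousMap.smul_apply, curveSMul_apply, curveSMul_apply,
        hf, hf', map_smul])
    (fun s => by rw [curveSMul_apply, hf, map_smul])
  rw [reGns_moment hN, reGns_moment hN, reGnsH_momentH hN]
  rw [map_add, map_smul, map_smul, map_smul, smul_eq_mul, smul_eq_mul, smul_eq_mul] at this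
  exact this

/-- The curve `s ↦ e (t, s) • X t`, jointly in `t` and `s`. -/
def smulPath {E : Type*} [TopologicalSpace E] [SMul ℝ E] [ContinuousSMul ℝ E]
    (e : C(ℝ × unitInterval, ℝ)) (X : C(ℝ, E)) : C(ℝ × unitInterval, E) :=
  ⟨fun p => e p • X p.1, e.continuous.smul (X.continuous.comp continuous_fst)⟩

theorem integral_reGns_moment (hN : (Fintype.card N : ℂ) ≠ 0) (e : C(ℝ × unitInterval, ℝ)) {c : ℝ}
    (he : ∀ s, ∫ t in (0:ℝ)..1, e (t, s) = c⁻¹) (X : Matrix N N ℂ) :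
    ∫ t in (0:ℝ)..1, reGns (moment φ (e.curry t)) X = c⁻¹ * φ (ContinuousMap.const _ X) := by
  obtain ⟨G, hG, hφ⟩ := exists_integral_curry (smulPath e (.const ℝ X)) 0 1
  have hGX : G = c⁻¹ • ContinuousMap.const _ X := by
    refine ContinuousMap.ext fun s => eq_of_reGns_eq hN fun Y => ?_
    have h := hG (LinearMap.toContinuousLinearMap ((reGns (N := N)).flip Y)) s
    change reGns (G s) Y = ∫ t in (0:ℝ)..1, reGns (e (t, s) • X) Y at h
    rw [h, ContinuousMap.smul_apply, ContinuousMap.const_apply, LinearMap.map_smul₂, ← he s,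
      smul_eq_mul, ← intervalIntegral.integral_mul_const]
    exact intervalIntegral.integral_congr fun t _ => LinearMap.map_smul₂ _ _ _ _
  have := hφ φ
  rw [hGX, map_smul, smul_eq_mul] at this
  rw [this]
  exact intervalIntegral.integral_congr fun t _ => reGns_moment hN _ _ _

theorem continuous_carre {W : ℝ → J → Matrix N N ℂ} (hW : Continuous W) :
    Continuous fun t => carre (W t) := by
  unfold carre
  fun_prop

theorem IsDualPair.integral_action_le (h : IsDualPair ε Vf ω ρ₀ ρ₁ D φ ψ)
    (hN : (Fintype.card N : ℂ) ≠ 0) {e : C(ℝ × unitInterval, ℝ)} (he₀ : ∀ p, 0 ≤ e p) {c r : ℝ}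
    (hc : 0 < c) (hr : 0 < r) (he : ∀ s, ∫ t in (0:ℝ)..1, e (t, s) = c⁻¹)
    {W : ℝ → J → Matrix N N ℂ} (hW : Continuous W) :
    ∫ t in (0:ℝ)..1, (c * reGnsH (momentH ψ (e.curry t)) (W t) -
      (1 / 2) * r * reGnsH (W t) (antiL (moment φ (e.curry t)) (W t))) ≤ c * D / r := by
  obtain ⟨G, hG, hφ⟩ := exists_integral_curry
    (smulPath e ⟨fun t => carre (W t), continuous_carre hW⟩) 0 1
  obtain ⟨Z, hZ, hψ⟩ := exists_integral_curry_pi (smulPath e ⟨W, hW⟩) 0 1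
  have hectn : ∀ s, Continuous fun t => e (t, s) := fun s =>
    e.continuous.comp (continuous_id.prodMk continuous_const)
  have hGr : ∀ ρ s, reGns ρ (G s) = ∫ t in (0:ℝ)..1, e (t, s) * reGns ρ (carre (W t)) := by
    intro ρ s
    have h := hG (LinearMap.toContinuousLinearMap (reGns ρ)) s
    refine h.trans (intervalIntegral.integral_congr fun t _ => ?_)
    exact map_smul (reGns ρ) _ _
  have hZr : ∀ Y s, reGnsH Y (Z s) = ∫ t in (0:ℝ)..1, e (t, s) * reGnsH Y (W t) := by
    intro Y s
    have h := hZ (LinearMap.toContinuousLinearMap (reGnsH Y)) s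
    refine h.trans (intervalIntegral.integral_congr fun t _ => ?_)
    exact map_smul (reGnsH Y) _ _
  have jensen : ∀ ρ : Matrix N N ℂ, ρ.PosSemidef → ∀ s,
      c * reGnsH (Z s) (antiL ρ (Z s)) ≤ reGns ρ (G s) := by
    intro ρ hρ s
    have hmono : ∫ t in (0:ℝ)..1, e (t, s) * (2 * reGnsH (antiL ρ (c • Z s)) (W t)) ≤
        ∫ t in (0:ℝ)..1, (e (t, s) * reGnsH (c • Z s) (antiL ρ (c • Z s)) +
          e (t, s) * reGns ρ (carre (W t))) := by
      refine intervalIntegral.integral_mono zero_le_one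
        (Continuous.intervalIntegrable ?_ _ _) (Continuous.intervalIntegrable ?_ _ _) fun t => ?_
      · exact (hectn s).mul (continuous_const.mul (continuous_reGnsH continuous_const hW))
      · exact ((hectn s).mul continuous_const).add ((hectn s).mul
          (continuous_reGns continuous_const (continuous_carre hW)))
      · have := two_anti_form_le hρ (c • Z s) (W t)
        rw [← reGnsH_opAnti_left ρ hρ.1, ← reGns_carre ρ hρ.1 (W t)] at this
        nlinarith [he₀ (t, s)]
    rw [intervalIntegral.integral_add, intervalIntegral.integral_mul_const, he, ← hGr] at hmono
    · simp only [mul_left_comm _ (2:ℝ)] at hmono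
      rw [intervalIntegral.integral_const_mul, ← hZr, reGnsH_opAnti_left ρ hρ.1] at hmono
      simp only [map_smul, LinearMap.smul_apply, smul_eq_mul] at hmono
      have : c⁻¹ * (c * (c * reGnsH (Z s) (antiL ρ (Z s)))) =
        c * reGnsH (Z s) (antiL ρ (Z s)) := by field_simp
      linarith
    · exact ((hectn s).mul continuous_const).intervalIntegrable _ _
    · exact ((hectn s).mul
        (continuous_reGns continuous_const (continuous_carre hW))).intervalIntegrable _ _
  have key := h.le_of_forall_le (-((1 / 2) * (r ^ 2 / c)) • G) (r • Z) fun s ρ hρ _ => by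
    simp only [ContinuousMap.smul_apply, map_smul, LinearMap.smul_apply, smul_eq_mul]
    have := mul_le_mul_of_nonneg_left (jensen ρ hρ s) (by positivity : 0 ≤ (1 / 2) * (r ^ 2 / c))
    have h2 : (1 / 2) * (r ^ 2 / c) * (c * reGnsH (Z s) (antiL ρ (Z s))) =
      1 / 2 * (r * (r * reGnsH (Z s) (antiL ρ (Z s)))) := by field_simp
    linarith
  rw [map_smul, map_smul, smul_eq_mul, smul_eq_mul, hφ, hψ] at key
  have e1 : ∀ t, φ ((smulPath e ⟨fun t => carre (W t), continuous_carre hW⟩).curry t) =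
      reGnsH (W t) (antiL (moment φ (e.curry t)) (W t)) := fun t => by
    rw [← reGns_carre _ (h.posSemidef_moment hN fun s => he₀ (t, s)).1, reGns_moment hN]
    rfl
  have e2 : ∀ t, ψ ((smulPath e ⟨W, hW⟩).curry t) = reGnsH (momentH ψ (e.curry t)) (W t) :=
    fun t => by
      rw [reGnsH_momentH hN]
      rfl
  simp only [e1, e2] at key
  rw [intervalIntegral.integral_sub, intervalIntegral.integral_const_mul,
    intervalIntegral.integral_const_mul, le_div_iff₀ hr]
  · have := mul_le_mul_of_nonneg_left key hc.le
    refine le_trans (le_of_eq ?_) this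
    field_simp
    ring
  · exact (continuous_const.mul
      (continuous_reGnsH (continuous_momentH ψ e) hW)).intervalIntegrable _ _
  · exact (continuous_const.mul (continuous_reGnsH hW
      (continuous_antiL (continuous_moment φ e) hW))).intervalIntegrable _ _

end DualPair

section Mollify

set_option linter.unusedSectionVars false

variable {N : Type*} [Fintype N] [DecidableEq N] {J : Type*} [Fintype J]

theorem moment_smul (φ : C(unitInterval, Matrix N N ℂ) →L[ℝ] ℝ) (r : ℝ) (f : C(unitInterval, ℝ)) :
    moment φ (r • f) = r • moment φ f := by
  ext i k
  rw [Matrix.smul_apply, moment_apply, moment_apply, map_smul, map_smul, Complex.real_smul,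
    smul_eq_mul, smul_eq_mul]
  push_cast
  ring

theorem momentH_smul (ψ : C(unitInterval, J → Matrix N N ℂ) →L[ℝ] ℝ) (r : ℝ)
    (f : C(unitInterval, ℝ)) : momentH ψ (r • f) = r • momentH ψ f :=
  funext fun _ => moment_smul _ r f

theorem moment_zero (φ : C(unitInterval, Matrix N N ℂ) →L[ℝ] ℝ) : moment φ 0 = 0 := by
  simpa using moment_smul φ 0 0

variable {ε : ℝ} {Vf : J → Matrix N N ℂ} {ω : J → ℝ} {ρ₀ ρ₁ : Matrix N N ℂ} {D : ℝ}
  {φ : C(unitInterval, Matrix N N ℂ) →L[ℝ] ℝ} {ψ : C(unitInterval, J → Matrix N N ℂ) →L[ℝ] ℝ}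

theorem IsDualPair.map_const_one (h : IsDualPair ε Vf ω ρ₀ ρ₁ D φ ψ) (h₁ : tau ρ₁ = 1) :
    φ (ContinuousMap.const _ 1) = 1 := by
  have := h.eq_of_hasDerivAt (fun t => t • 1) (fun _ => 1) continuous_const
    (fun t i k => by
      have := (hasDerivAt_id t).smul_const ((1 : Matrix N N ℂ) i k)
      rw [one_smul] at this
      exact this) (ContinuousMap.const _ 1) 0
    (fun s => by simp [genL_one]) (fun s => by simp [gradL_one])
  simpa [reGns_one h₁] using this

/-- Smoothing a dual pair in time, at scale `h`, after shrinking it to the interior of the unit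
interval; `p₀` and `p₁` are the weights left at the end points. -/
theorem IsDualPair.exists_mollified (H : IsDualPair ε Vf ω ρ₀ ρ₁ D φ ψ)
    (hN : (Fintype.card N : ℂ) ≠ 0) (h₀ : tau ρ₀ = 1) (h₁ : tau ρ₁ = 1) {h : ℝ} (hh : 0 < h) :
    ∃ (μ μ' : ℝ → Matrix N N ℂ) (P : ℝ → J → Matrix N N ℂ) (p₀ p₁ q₀ q₁ : ℝ → ℝ),
      (∀ t, (μ t).PosSemidef) ∧ Continuous μ ∧ Continuous μ' ∧ Continuous P ∧
      (∀ t i k, HasDerivAt (fun u => μ u i k) (μ' t i k) t) ∧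
      (∀ t, HasDerivAt p₀ (q₀ t) t) ∧ (∀ t, HasDerivAt p₁ (q₁ t) t) ∧
      Continuous q₀ ∧ Continuous q₁ ∧ (∀ t, 0 ≤ p₀ t) ∧ (∀ t, 0 ≤ p₁ t) ∧
      (∀ t, reGns (μ t) 1 + p₀ t + p₁ t = 1) ∧
      (∀ t X, reGns (μ' t) X + q₀ t * reGns ρ₀ X + q₁ t * reGns ρ₁ X =
        (1 + 2 * h) * (ε * reGns (μ t) (genLin Vf ω X) + reGnsH (P t) (gradL Vf X))) ∧
      μ 0 = 0 ∧ μ 1 = 0 ∧ p₀ 0 = 1 ∧ p₁ 0 = 0 ∧ p₀ 1 = 0 ∧ p₁ 1 = 1 ∧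
      (∀ X, ∫ t in (0:ℝ)..1, reGns (μ t) X = (1 + 2 * h)⁻¹ * φ (ContinuousMap.const _ X)) ∧
      ∀ r W, 0 < r → Continuous W → ∫ t in (0:ℝ)..1, ((1 + 2 * h) * reGnsH (P t) (W t) -
        (1 / 2) * r * reGnsH (W t) (antiL (μ t) (W t))) ≤ (1 + 2 * h) * D / r := by
  obtain ⟨S, g, g', hg', hS, hg, hg0, hS0, hS1, hSl, hSr, hgl, hgr⟩ := exists_smooth_step
  set c := 1 + 2 * h with hc
  have hc0 : 0 < c := by positivity
  have hgc : Continuous g := continuous_iff_continuousAt.2 fun x => (hg x).continuousAt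
  have hkt : ∀ t s : ℝ, HasDerivAt (fun u => (c * u - s) / (2 * h)) (c / (2 * h)) t := by
    intro t s
    simpa using (((hasDerivAt_id t).const_mul c).sub_const s).div_const (2 * h)
  have hks : ∀ t s : ℝ, HasDerivAt (fun u => (c * t - u) / (2 * h)) (-1 / (2 * h)) s := by
    intro t s
    simpa using ((hasDerivAt_id s).const_sub (c * t)).div_const (2 * h)
  let e : C(ℝ × unitInterval, ℝ) :=
    ⟨fun p => g ((c * p.1 - p.2) / (2 * h)) / (2 * h), by fun_prop⟩
  let e' : C(ℝ × unitInterval, ℝ) :=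
    ⟨fun p => g' ((c * p.1 - p.2) / (2 * h)) * (c / (2 * h)) / (2 * h), by fun_prop⟩
  have he0 : ∀ p, 0 ≤ e p := fun p => div_nonneg (hg0 _) (by positivity)
  have hee' : ∀ t s, HasDerivAt (fun u => e (u, s)) (e' (t, s)) t := fun t s =>
    ((hg _).comp t (hkt t s)).div_const _
  have hint : ∀ s, ∫ t in (0:ℝ)..1, e (t, s) = c⁻¹ := by
    intro s
    have hd : ∀ t, HasDerivAt (fun u => c⁻¹ * S ((c * u - s) / (2 * h))) (e (t, s)) t := by
      intro t
      refine (((hS _).comp t (hkt t s)).const_mul c⁻¹).congr_deriv ?_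
      change _ = g _ / (2 * h)
      field_simp
    rw [intervalIntegral.integral_eq_sub_of_hasDerivAt (fun t _ => hd t)
      ((e.continuous.comp (continuous_id.prodMk continuous_const)).intervalIntegrable _ _),
      hSr ((c * 1 - s) / (2 * h)) ((one_le_div (by positivity)).2 (by rw [hc]; linarith [s.2.2])),
      hSl _ (div_nonpos_of_nonpos_of_nonneg (by linarith [s.2.1]) (by positivity))]
    simp
  have hμ0 : e.curry 0 = 0 := by
    refine ContinuousMap.ext fun s => ?_
    change g _ / (2 * h) = 0
    rw [hgl _ (div_nonpos_of_nonpos_of_nonneg (by simpa using s.2.1) (by positivity)), zero_div]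
  have hμ1 : e.curry 1 = 0 := by
    refine ContinuousMap.ext fun s => ?_
    change g _ / (2 * h) = 0
    rw [hgr _ ((one_le_div (by positivity)).2 (by simp only [hc]; linarith [s.2.2])), zero_div]
  refine ⟨fun t => moment φ (e.curry t), fun t => moment φ (e'.curry t),
    fun t => momentH ψ (e.curry t), fun t => 1 - S ((c * t - 0) / (2 * h)),
    fun t => S ((c * t - 1) / (2 * h)), fun t => -(g ((c * t - 0) / (2 * h)) * (c / (2 * h))),
    fun t => g ((c * t - 1) / (2 * h)) * (c / (2 * h)),
    fun t => H.posSemidef_moment hN fun s => he0 _, continuous_moment φ e, continuous_moment φ e',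
    continuous_momentH ψ e, hasDerivAt_moment φ e e' hee',
    fun t => ((hS _).comp t (hkt t 0)).const_sub 1, fun t => (hS _).comp t (hkt t 1),
    by fun_prop, by fun_prop, fun t => sub_nonneg.2 (hS1 _), fun t => hS0 _, fun t => ?_,
    fun t X => ?_, by simp only [hμ0, moment_zero], by simp only [hμ1, moment_zero], ?_, ?_, ?_, ?_,
    integral_reGns_moment hN e hint,
    fun r W hr hW => H.integral_action_le hN he0 hc0 hr hint hW⟩
  · have := H.moment_eq hN (a := fun s => -S ((c * t - s) / (2 * h)))
      (a' := fun s => g ((c * t - s) / (2 * h)) / (2 * h)) (by fun_prop)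
      (fun s => ((hS _).comp s (hks t s)).neg.congr_deriv (by ring))
      (f := ⟨fun s => -S ((c * t - s) / (2 * h)), by
        have : Continuous S := continuous_iff_continuousAt.2 fun x => (hS x).continuousAt
        fun_prop⟩) (f' := e.curry t) (fun _ => rfl) (fun _ => rfl) 1
    simp only [genL_one, gradL_one, map_zero, reGns_one h₀, reGns_one h₁] at this
    linarith
  · have := H.moment_eq hN (a := fun s => -c * (g ((c * t - s) / (2 * h)) / (2 * h)))
      (a' := fun s => g' ((c * t - s) / (2 * h)) * (c / (2 * h)) / (2 * h)) (by fun_prop)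
      (fun s => (((hg _).comp s (hks t s)).div_const (2 * h)).const_mul (-c)
        |>.congr_deriv (by ring))
      (f := (-c) • e.curry t) (f' := e'.curry t) (fun _ => rfl) (fun _ => rfl) X
    rw [moment_smul, momentH_smul, LinearMap.map_smul₂, LinearMap.map_smul₂, smul_eq_mul,
      smul_eq_mul] at this
    linear_combination this
  · simp [hSl]
  · simp only [mul_zero, zero_sub]
    exact hSl _ (div_nonpos_of_nonpos_of_nonneg (by simp) (by positivity))
  · exact sub_eq_zero.2 (hSr _ ((one_le_div (by positivity)).2 (by rw [hc]; linarith))).symm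
  · exact hSr _ ((one_le_div (by positivity)).2 (by rw [hc]; linarith))

end Mollify

section Recovery

set_option linter.unusedSectionVars false

variable {N : Type*} [Fintype N] [DecidableEq N] {J : Type*} [Fintype J]

theorem continuous_heatL (Vf : J → Matrix N N ℂ) (ω : J → ℝ) {ρ : ℝ → Matrix N N ℂ}
    (hρ : Continuous ρ) : Continuous fun t => heatL Vf ω (ρ t) := by
  refine continuous_pi fun j => ?_
  simp only [heatL_apply]
  fun_prop

/-- Any two invertible density matrices are joined by a smooth curve solving the continuity
equation. -/
theorem exists_reference_curve (hN : (Fintype.card N : ℂ) ≠ 0) (ε : ℝ)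
    {Vf : J → Matrix N N ℂ} {ω : J → ℝ}
    (herg : ∀ A : Matrix N N ℂ, genL Vf ω A = 0 → ∃ c : ℂ, A = c • (1 : Matrix N N ℂ))
    {ρ₀ ρ₁ : Matrix N N ℂ} (h₀ : ρ₀.PosDef) (h₀tr : tau ρ₀ = 1) (h₁ : ρ₁.PosDef)
    (h₁tr : tau ρ₁ = 1) :
    ∃ (γ γ' : ℝ → Matrix N N ℂ) (V : ℝ → J → Matrix N N ℂ),
      (∀ t, (γ t).PosDef) ∧ (∀ t, tau (γ t) = 1) ∧ Continuous γ ∧ Continuous γ' ∧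
      Continuous V ∧ (∀ t i k, HasDerivAt (fun u => γ u i k) (γ' t i k) t) ∧ γ 0 = ρ₀ ∧ γ 1 = ρ₁ ∧
      ∀ t X, reGns (γ' t) X = ε * reGns (γ t) (genLin Vf ω X) + reGnsH (V t) (gradL Vf X) := by
  obtain ⟨S, g, g', -, hS, hg, -, hS0, hS1, hSl, hSr, -, -⟩ := exists_smooth_step
  obtain ⟨V, hV⟩ := exists_reGnsH_gradL_eq hN herg (X := ρ₁ - ρ₀) (by
    rw [tau_sub, h₀tr, h₁tr, sub_self])
  have hSc : Continuous S := continuous_iff_continuousAt.2 fun x => (hS x).continuousAt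
  have hgc : Continuous g := continuous_iff_continuousAt.2 fun x => (hg x).continuousAt
  have hγ : Continuous fun t => ρ₀ + S t • (ρ₁ - ρ₀) := by fun_prop
  have hconv : ∀ t, ρ₀ + S t • (ρ₁ - ρ₀) = (1 - S t) • ρ₀ + S t • ρ₁ := fun t => by
    module
  refine ⟨fun t => ρ₀ + S t • (ρ₁ - ρ₀), fun t => g t • (ρ₁ - ρ₀),
    fun t => ε • heatL Vf ω (ρ₀ + S t • (ρ₁ - ρ₀)) + g t • V, fun t => ?_, fun t => ?_, hγ,
    by fun_prop, ((continuous_heatL Vf ω hγ).const_smul ε).add (hgc.smul continuous_const),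
    fun t i k => ((hS t).smul_const ((ρ₁ - ρ₀) i k)).const_add (ρ₀ i k), ?_, ?_, fun t X => ?_⟩
  · change (ρ₀ + S t • (ρ₁ - ρ₀)).PosDef
    rw [hconv]
    rcases (hS0 t).eq_or_lt with h | h
    · simpa [← h] using h₀
    · exact (h₁.smul h).posSemidef_add (h₀.posSemidef.smul (sub_nonneg.2 (hS1 t)))
  · rw [tau_add, tau_smul, tau_sub, h₀tr, h₁tr]
    simp
  · simp [hSl]
  · simp [hSr]
  · have hU := reGns_heat Vf ω (ρ₀ + S t • (ρ₁ - ρ₀)) X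
    have hVX := hV X
    simp only [LinearMap.map_add₂, LinearMap.map_smul₂, smul_eq_mul] at hU hVX ⊢
    rw [hU, hVX]
    ring

/-- The pointwise estimate behind the recovery of a genuine solution of the continuity equation. -/
theorem mixed_action_le (Vf : J → Matrix N N ℂ) (ω : J → ℝ) (ε : ℝ) {h p₀ p₁ : ℝ} (hh : 0 ≤ h)
    (hh' : h ≤ 1) (hp₀ : 0 ≤ p₀) (hp₁ : 0 ≤ p₁) {ρ₀ ρ₁ μ γ : Matrix N N ℂ}
    (h₀ : ρ₀.PosSemidef) (h₁ : ρ₁.PosSemidef) (hμ : μ.PosSemidef) (hγ : γ.PosSemidef)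
    (P Z W : J → Matrix N N ℂ) (c : ℝ) :
    reGnsH ((1 - h) • (c • P - (2 * h * ε) • heatL Vf ω μ + (ε * p₀) • heatL Vf ω ρ₀ +
        (ε * p₁) • heatL Vf ω ρ₁) + h • antiL γ Z) W -
      (1 / 2) * reGnsH W (antiL ((1 - h) • (μ + p₀ • ρ₀ + p₁ • ρ₁) + h • γ) W) ≤
    (1 - h) * ((c * reGnsH P W - (1 / 2) * (1 - h) * reGnsH W (antiL μ W)) +
      4 * h * ε ^ 2 * reGns μ (heatWeight Vf ω) + ε ^ 2 * (p₀ * reGns ρ₀ (heatWeight Vf ω) +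
        p₁ * reGns ρ₁ (heatWeight Vf ω))) + h * ((1 / 2) * reGnsH Z (antiL γ Z)) := by
  have e0 := mul_le_mul_of_nonneg_left (mul_reGnsH_heatL_le Vf ω h₀ W ε) hp₀
  have e1 := mul_le_mul_of_nonneg_left (mul_reGnsH_heatL_le Vf ω h₁ W ε) hp₁
  have e2 := mul_le_mul_of_nonneg_left (mul_reGnsH_heatL_le Vf ω hμ W (-2 * ε)) hh
  have e3 := mul_le_mul_of_nonneg_left (add_le_add (add_le_add e0 e1) e2) (sub_nonneg.2 hh')
  have e4 := mul_le_mul_of_nonneg_left (two_anti_form_le hγ W Z) hh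
  have e5 : reGnsH (antiL γ Z) W = reGnsH W (antiL γ Z) := reGnsH_comm _ _
  simp only [map_add, map_sub, map_smul, LinearMap.add_apply, LinearMap.sub_apply,
    LinearMap.smul_apply, smul_eq_mul, e5]
  nlinarith [e3, e4]

variable {ε : ℝ} {Vf : J → Matrix N N ℂ} {ω : J → ℝ} {ρ₀ ρ₁ : Matrix N N ℂ} {D : ℝ}
  {φ : C(unitInterval, Matrix N N ℂ) →L[ℝ] ℝ} {ψ : C(unitInterval, J → Matrix N N ℂ) →L[ℝ] ℝ}

theorem tau_eq_one_of_reGns {ρ : Matrix N N ℂ} (hρ : ρ.IsHermitian) (h : reGns ρ 1 = 1) :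
    tau ρ = 1 := by
  have h1 : star (tau ρ) = tau ρ := by
    have := tau_conjTranspose ρ
    rw [hρ.eq] at this
    exact this.symm
  have h2 : (tau ρ).re = 1 := by
    rw [reGns_apply, gns, Matrix.mul_one, hρ.eq] at h
    exact h
  have h3 := Complex.conj_eq_iff_re.1 h1
  rw [← h3, h2, Complex.ofReal_one]

theorem integral_le_of_forall_le {q f₁ f₂ f₃ f₄ : ℝ → ℝ} (hq : Continuous q) (h₁ : Continuous f₁)
    (h₂ : Continuous f₂) (h₃ : Continuous f₃) (h₄ : Continuous f₄) {a b c d e : ℝ}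
    (h : ∀ t, a * q t ≤ b * (f₁ t + c * f₂ t + d * (1 - f₃ t)) + e * f₄ t) :
    a * ∫ t in (0:ℝ)..1, q t ≤ b * ((∫ t in (0:ℝ)..1, f₁ t) + c * (∫ t in (0:ℝ)..1, f₂ t) +
      d * (1 - ∫ t in (0:ℝ)..1, f₃ t)) + e * ∫ t in (0:ℝ)..1, f₄ t := by
  have ii : ∀ f : ℝ → ℝ, Continuous f → IntervalIntegrable f volume 0 1 :=
    fun f hf => hf.intervalIntegrable 0 1
  have := intervalIntegral.integral_mono zero_le_one (ii (fun t => a * q t) (by fun_prop))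
    (ii (fun t => b * (f₁ t + c * f₂ t + d * (1 - f₃ t)) + e * f₄ t) (by fun_prop)) h
  rw [intervalIntegral.integral_const_mul,
    intervalIntegral.integral_add (ii _ (by fun_prop)) (ii _ (by fun_prop)),
    intervalIntegral.integral_const_mul, intervalIntegral.integral_const_mul,
    intervalIntegral.integral_add (ii _ (by fun_prop)) (ii _ (by fun_prop)),
    intervalIntegral.integral_add (ii _ (by fun_prop)) (ii _ (by fun_prop)),
    intervalIntegral.integral_const_mul, intervalIntegral.integral_const_mul,
    intervalIntegral.integral_sub (ii _ (by fun_prop)) (ii _ (by fun_prop)),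
    intervalIntegral.integral_const, sub_zero, one_smul] at this
  exact this

theorem IsDualPair.exists_isCE (H : IsDualPair ε Vf ω ρ₀ ρ₁ D φ ψ)
    (hN : (Fintype.card N : ℂ) ≠ 0)
    (herg : ∀ A : Matrix N N ℂ, genL Vf ω A = 0 → ∃ c : ℂ, A = c • (1 : Matrix N N ℂ))
    {dvg : (J → Matrix N N ℂ) → Matrix N N ℂ}
    (hdvg : ∀ (W : J → Matrix N N ℂ) (B : Matrix N N ℂ),
      gns (dvg W) B = -∑ j, gns (W j) (Vf j * B - B * Vf j))
    {Ldag : Matrix N N ℂ → Matrix N N ℂ}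
    (hLdag : ∀ ρ B : Matrix N N ℂ, gns (Ldag ρ) B = gns ρ (genL Vf ω B))
    (h₀ : ρ₀.PosDef) (h₀tr : tau ρ₀ = 1) (h₁ : ρ₁.PosDef) (h₁tr : tau ρ₁ = 1) :
    ∃ K : ℝ, ∀ h : ℝ, 0 < h → h < 1 → ∃ ρ V, IsCE dvg Ldag ε ρ₀ ρ₁ ρ V ∧
      ∫⁻ t in Set.Icc (0:ℝ) 1, invQuadH (opAnti (ρ t)) (V t) ≤
        ENNReal.ofReal (2 * (D + h * K)) := by
  obtain ⟨γ, γ', Vγ, hγpos, hγtr, hγc, hγc', hVγc, hγd, hγ0, hγ1, hγeq⟩ :=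
    exists_reference_curve hN ε herg h₀ h₀tr h₁ h₁tr
  obtain ⟨Z, hZc, hZ⟩ := exists_continuous_antiL_eq hN hγc hγpos hVγc
  set M := heatWeight Vf ω with hM
  set C := ∫ t in (0:ℝ)..1, (1 / 2) * reGnsH (Z t) (antiL (γ t) (Z t)) with hC
  set m := |reGns ρ₀ M| + |reGns ρ₁ M| with hm
  refine ⟨2 * D + 4 * ε ^ 2 * |φ (ContinuousMap.const _ M)| + 2 * ε ^ 2 * m + C,
    fun h hh hh' => ?_⟩
  obtain ⟨μ, μ', P, p₀, p₁, q₀, q₁, hμ, hμc, hμc', hPc, hμd, hp₀d, hp₁d, hq₀c, hq₁c, hp₀, hp₁,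
    hmass, heq, hμ0, hμ1, hp₀0, hp₁0, hp₀1, hp₁1, hint, hact⟩ :=
    H.exists_mollified hN h₀tr h₁tr hh
  have hp₀c : Continuous p₀ := continuous_iff_continuousAt.2 fun x => (hp₀d x).continuousAt
  have hp₁c : Continuous p₁ := continuous_iff_continuousAt.2 fun x => (hp₁d x).continuousAt
  set ρ : ℝ → Matrix N N ℂ :=
    fun t => (1 - h) • (μ t + p₀ t • ρ₀ + p₁ t • ρ₁) + h • γ t with hρ
  set V : ℝ → J → Matrix N N ℂ := fun t => (1 - h) • ((1 + 2 * h) • P t -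
    (2 * h * ε) • heatL Vf ω (μ t) + (ε * p₀ t) • heatL Vf ω ρ₀ + (ε * p₁ t) • heatL Vf ω ρ₁) +
      h • antiL (γ t) (Z t) with hV
  have hρc : Continuous ρ := by fun_prop
  have hVc : Continuous V := by
    have := continuous_heatL Vf ω hμc
    have := continuous_antiL hγc hZc
    fun_prop
  have hρpos : ∀ t, (ρ t).PosDef := fun t =>
    ((hγpos t).smul hh).posSemidef_add ((((hμ t).add (h₀.posSemidef.smul (hp₀ t))).add
      (h₁.posSemidef.smul (hp₁ t))).smul (sub_nonneg.2 hh'.le))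
  obtain ⟨W, hWc, hW⟩ := exists_continuous_antiL_eq hN hρc hρpos hVc
  have hCE : IsCE dvg Ldag ε ρ₀ ρ₁ ρ V := by
    refine ⟨?_, ?_, fun t _ => ⟨hρpos t, ?_⟩, fun j i k => Continuous.continuousOn ?_,
      fun t => (1 - h) • (μ' t + q₀ t • ρ₀ + q₁ t • ρ₁) + h • γ' t, fun t _ i k => ?_,
      fun i k => Continuous.continuousOn ?_, fun t _ => ?_⟩
    · simp only [hρ, hμ0, hp₀0, hp₁0, hγ0]
      module
    · simp only [hρ, hμ1, hp₀1, hp₁1, hγ1]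
      module
    · refine tau_eq_one_of_reGns (hρpos t).isHermitian ?_
      simp only [hρ, LinearMap.map_add₂, LinearMap.map_smul₂, smul_eq_mul, reGns_one h₀tr,
        reGns_one h₁tr, reGns_one (hγtr t)]
      linear_combination (1 - h) * hmass t
    · fun_prop
    · exact ((((hμd t i k).add ((hp₀d t).smul_const (ρ₀ i k))).add
        ((hp₁d t).smul_const (ρ₁ i k))).const_smul (1 - h)).add ((hγd t i k).const_smul h)
    · have : Continuous fun t => (1 - h) • (μ' t + q₀ t • ρ₀ + q₁ t • ρ₁) + h • γ' t := by
        fun_prop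
      fun_prop
    · refine eq_of_reGns_eq hN fun X => ?_
      have hd : reGns (dvg (V t)) X = - reGnsH (V t) (gradL Vf X) := by
        rw [reGns_apply, hdvg, Complex.neg_re, Complex.re_sum]
        rfl
      have hl : reGns (Ldag (ρ t)) X = reGns (ρ t) (genLin Vf ω X) := by
        rw [reGns_apply, hLdag]
        rfl
      rw [LinearMap.map_add₂, hd, LinearMap.map_smul₂, hl]
      have hγX := hγeq t X
      rw [← hZ] at hγX
      simp only [hρ, hV, LinearMap.map_add₂, LinearMap.map_sub₂, LinearMap.map_smul₂, reGns_heat,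
        smul_eq_mul]
      linear_combination (1 - h) * heq t X + h * hγX
  refine ⟨ρ, V, hCE, ?_⟩
  have hQ : ∀ t, invQuadH (opAnti (ρ t)) (V t) =
      ENNReal.ofReal (reGnsH (W t) (antiL (ρ t) (W t))) := fun t =>
    invQuadH_opAnti (hρpos t) hN (hW t)
  have hQc : Continuous fun t => reGnsH (W t) (antiL (ρ t) (W t)) :=
    continuous_reGnsH hWc (continuous_antiL hρc hWc)
  simp only [hQ]
  rw [← ofReal_integral_eq_lintegral_ofReal (hQc.integrableOn_Icc)
    (Filter.Eventually.of_forall fun t => anti_form_nonneg (hρpos t).posSemidef _),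
    integral_Icc_eq_integral_Ioc, ← intervalIntegral.integral_of_le zero_le_one]
  refine ENNReal.ofReal_le_ofReal ?_
  have hpt : ∀ t, (1 / 2) * reGnsH (W t) (antiL (ρ t) (W t)) ≤
      (1 - h) * (((1 + 2 * h) * reGnsH (P t) (W t) -
        (1 / 2) * (1 - h) * reGnsH (W t) (antiL (μ t) (W t))) +
        4 * h * ε ^ 2 * reGns (μ t) M + ε ^ 2 * m * (1 - reGns (μ t) 1)) +
        h * ((1 / 2) * reGnsH (Z t) (antiL (γ t) (Z t))) := by
    intro t
    have h1 := mixed_action_le Vf ω ε hh.le hh'.le (hp₀ t) (hp₁ t) h₀.posSemidef h₁.posSemidef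
      (hμ t) (hγpos t).posSemidef (P t) (Z t) (W t) (1 + 2 * h)
    have h2 : reGnsH (V t) (W t) = reGnsH (W t) (antiL (ρ t) (W t)) := by
      rw [← hW, reGnsH_comm]
    change reGnsH (V t) (W t) - (1 / 2) * reGnsH (W t) (antiL (ρ t) (W t)) ≤ _ at h1
    rw [h2] at h1
    have h3 : p₀ t * reGns ρ₀ M + p₁ t * reGns ρ₁ M ≤ m * (1 - reGns (μ t) 1) := by
      have : 1 - reGns (μ t) 1 = p₀ t + p₁ t := by linarith [hmass t]
      rw [this]
      nlinarith [mul_le_mul_of_nonneg_left (le_abs_self (reGns ρ₀ M)) (hp₀ t),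
        mul_le_mul_of_nonneg_left (le_abs_self (reGns ρ₁ M)) (hp₁ t),
        mul_nonneg (hp₀ t) (abs_nonneg (reGns ρ₁ M)), mul_nonneg (hp₁ t) (abs_nonneg (reGns ρ₀ M))]
    have h4 := mul_le_mul_of_nonneg_left (mul_le_mul_of_nonneg_left h3 (sq_nonneg ε))
      (sub_nonneg.2 hh'.le)
    linarith
  have c1 : Continuous fun t => (1 + 2 * h) * reGnsH (P t) (W t) -
      (1 / 2) * (1 - h) * reGnsH (W t) (antiL (μ t) (W t)) :=
    (continuous_const.mul (continuous_reGnsH hPc hWc)).sub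
      (continuous_const.mul (continuous_reGnsH hWc (continuous_antiL hμc hWc)))
  have c4 : Continuous fun t => (1 / 2) * reGnsH (Z t) (antiL (γ t) (Z t)) :=
    continuous_const.mul (continuous_reGnsH hZc (continuous_antiL hγc hZc))
  have hle := integral_le_of_forall_le hQc c1 (continuous_reGns hμc continuous_const)
    (continuous_reGns hμc continuous_const) c4 hpt
  rw [hint, hint, H.map_const_one h₁tr, ← hC] at hle
  have hact' := mul_le_mul_of_nonneg_left (hact (1 - h) W (sub_pos.2 hh') hWc)
    (sub_nonneg.2 hh'.le)
  rw [mul_div_cancel₀ _ (sub_pos.2 hh').ne'] at hact'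
  have hinv0 : 0 ≤ (1 + 2 * h)⁻¹ := by positivity
  have hinv : (1 + 2 * h)⁻¹ ≤ 1 := inv_le_one_of_one_le₀ (by linarith)
  have hinv' : 1 - (1 + 2 * h)⁻¹ ≤ 2 * h := by
    have : (1 + 2 * h) * (1 + 2 * h)⁻¹ = 1 := mul_inv_cancel₀ (by positivity)
    nlinarith
  have b1 : (1 - h) * (4 * h * ε ^ 2 * ((1 + 2 * h)⁻¹ * φ (ContinuousMap.const _ M))) ≤
      h * (4 * ε ^ 2 * |φ (ContinuousMap.const _ M)|) := by
    have h1 : (1 - h) * (1 + 2 * h)⁻¹ * φ (ContinuousMap.const _ M) ≤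
        |φ (ContinuousMap.const _ M)| := by
      refine (mul_le_mul_of_nonneg_left (le_abs_self _)
        (mul_nonneg (sub_nonneg.2 hh'.le) hinv0)).trans (mul_le_of_le_one_left (abs_nonneg _) ?_)
      exact mul_le_one₀ (by linarith) hinv0 hinv
    have := mul_le_mul_of_nonneg_left h1 (by positivity : 0 ≤ 4 * h * ε ^ 2)
    linarith
  have b2 : (1 - h) * (ε ^ 2 * m * (1 - (1 + 2 * h)⁻¹ * 1)) ≤ h * (2 * ε ^ 2 * m) := by
    have hm0 : 0 ≤ ε ^ 2 * m := by positivity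
    have h1 : (1 - h) * (1 - (1 + 2 * h)⁻¹) ≤ 2 * h := by nlinarith
    have := mul_le_mul_of_nonneg_left h1 hm0
    linarith
  linarith

end Recovery

/-- **Duality formula, anticommutator case** (Carlen–Gao–Gordina–Timoney / Wirth):
`½ W_{anti,ε}²(ρ₀,ρ₁) = sup { τ(A(1)ρ₁ - A(0)ρ₀) : A an anticommutator HJB_ε subsolution }`. -/
theorem duality_formula_anticommutator
    {N : Type*} [Fintype N] [DecidableEq N] {J : Type*} [Fintype J]
    (ε : ℝ) (hε : 0 ≤ ε)
    (st : J → J) (Vf : J → Matrix N N ℂ) (ω : J → ℝ)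
    (hON : ∀ j k, tau ((Vf j)ᴴ * Vf k) = if j = k then 1 else 0)
    (htr : ∀ j, tau (Vf j) = 0)
    (hstinv : ∀ j, st (st j) = j)
    (hVst : ∀ j, Vf (st j) = (Vf j)ᴴ)
    (hωst : ∀ j, ω (st j) = -ω j)
    (σ : Matrix N N ℂ) (hσ : σ.PosDef) (hσtr : tau σ = 1)
    (hDBC : ∀ j, σ * Vf j = Real.exp (-ω j) • (Vf j * σ))
    (herg : ∀ A : Matrix N N ℂ, genL Vf ω A = 0 → ∃ c : ℂ, A = c • (1 : Matrix N N ℂ))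
    (dvg : (J → Matrix N N ℂ) → Matrix N N ℂ)
    (hdvg : ∀ (W : J → Matrix N N ℂ) (B : Matrix N N ℂ),
      gns (dvg W) B = -∑ j, gns (W j) (Vf j * B - B * Vf j))
    (Ldag : Matrix N N ℂ → Matrix N N ℂ)
    (hLdag : ∀ ρ B : Matrix N N ℂ, gns (Ldag ρ) B = gns ρ (genL Vf ω B))
    (ρ₀ ρ₁ : Matrix N N ℂ)
    (h₀ : ρ₀.PosDef) (h₀tr : tau ρ₀ = 1) (h₁ : ρ₁.PosDef) (h₁tr : tau ρ₁ = 1) :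
    WsqAnti dvg Ldag ε ρ₀ ρ₁ / 2 =
      ⨆ (A : ℝ → Matrix N N ℂ) (A' : ℝ → Matrix N N ℂ) (_ : IsHJBanti Vf ω ε A A'),
        ENNReal.ofReal (tau (A 1 * ρ₁ - A 0 * ρ₀)).re := by
  have hN := card_ne_zero_of_tau h₀tr
  refine le_antisymm ?_ ?_
  · set s := ⨆ (A : ℝ → Matrix N N ℂ) (A' : ℝ → Matrix N N ℂ) (_ : IsHJBanti Vf ω ε A A'),
      ENNReal.ofReal (tau (A 1 * ρ₁ - A 0 * ρ₀)).re with hs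
    rcases eq_or_ne s ⊤ with htop | htop
    · rw [htop]
      exact le_top
    have hD : ∀ A A', IsHJBanti Vf ω ε A A' → (tau (A 1 * ρ₁ - A 0 * ρ₀)).re ≤ s.toReal := by
      intro A A' hA
      have : ENNReal.ofReal (tau (A 1 * ρ₁ - A 0 * ρ₀)).re ≤ s :=
        le_iSup_of_le A (le_iSup_of_le A' (le_iSup_of_le hA le_rfl))
      exact (ENNReal.ofReal_le_iff_le_toReal htop).1 this
    obtain ⟨φ, ψ, hφψ, hle⟩ := exists_dual_functionals hstinv hVst hωst h₀.isHermitian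
      h₁.isHermitian h₁tr hD
    obtain ⟨K, hK⟩ := IsDualPair.exists_isCE ⟨hφψ, hle⟩ hN herg hdvg hLdag h₀ h₀tr h₁ h₁tr
    have hbound : ∀ h ∈ Set.Ioo (0:ℝ) 1,
        WsqAnti dvg Ldag ε ρ₀ ρ₁ / 2 ≤ ENNReal.ofReal (s.toReal + h * K) := by
      intro h hh
      obtain ⟨ρ, V, hCE, hle⟩ := hK h hh.1 hh.2
      have hW : WsqAnti dvg Ldag ε ρ₀ ρ₁ ≤ ENNReal.ofReal (2 * (s.toReal + h * K)) := by
        unfold WsqAnti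
        exact iInf_le_of_le ρ (iInf_le_of_le V (iInf_le_of_le hCE hle))
      rw [ENNReal.ofReal_mul (by norm_num), ENNReal.ofReal_ofNat] at hW
      exact ENNReal.div_le_of_le_mul' hW
    have hlim : Filter.Tendsto (fun h : ℝ => ENNReal.ofReal (s.toReal + h * K))
        (nhdsWithin 0 (Set.Ioi 0)) (nhds s) := by
      have hc : Continuous fun h : ℝ => ENNReal.ofReal (s.toReal + h * K) :=
        ENNReal.continuous_ofReal.comp (by fun_prop)
      have := hc.tendsto 0
      rw [zero_mul, add_zero, ENNReal.ofReal_toReal htop] at this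
      exact this.mono_left nhdsWithin_le_nhds
    exact ge_of_tendsto hlim (Filter.eventually_of_mem (Ioo_mem_nhdsGT one_pos) hbound)
  · refine iSup_le fun A => iSup_le fun A' => iSup_le fun hA => ?_
    rw [ENNReal.le_div_iff_mul_le (by simp) (by simp)]
    refine le_iInf fun ρ => le_iInf fun V => le_iInf fun hCE => ?_
    rw [← ENNReal.le_div_iff_mul_le (by simp) (by simp)]
    exact le_action_of_isHJBanti hdvg hLdag hN hCE hA
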